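/- arXiv:1910.01475 — 2 statements merged into one kernel-verified Lean document; each statement's English description precedes it below -/
import Mathlib

section
/- Let φ be an elliptic automorphism of 𝔻 of infinite order with fixed point α ∈ 𝔻, and let w belong to the disc algebra A(𝔻) with |w| bounded away from 0 on 𝔻. Suppose the weighted composition operator T_{w,φ} on the Hardy space H² satisfies sup_n ‖T_{w,φ}ⁿ‖ < ∞. Then (T_{w,φ}ⁿ) converges in operator norm if and only if |w(α)| < 1. -/
open Complex Metric Filter Topology

/-- The Hardy space `H²`, realized as the sequence space `ℓ²` of Taylor coefficients. -/
noncomputable abbrev H2 : Type := lp (fun _ : ℕ => ℂ) 2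

/-- Evaluation of an element of `H²` (a coefficient sequence) at a point of the disc. -/
noncomputable def H2.eval (f : H2) (z : ℂ) : ℂ := ∑' n : ℕ, f n * z ^ n

lemma exists_isom {E : Type*} [NormedAddCommGroup E] [InnerProductSpace ℂ E] [CompleteSpace E]
    (v : ℕ → E) (hv : Orthonormal ℂ v) :
    ∃ V : H2 →ₗᵢ[ℂ] E, ∀ f : H2, HasSum (fun n => f n • v n) (V f) := by
  refine ⟨hv.orthogonalFamily.linearIsometry, fun f => ?_⟩
  have := hv.orthogonalFamily.hasSum_linearIsometry f
  simpa using this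

lemma exists_ker (z : ℂ) (hz : z ∈ ball (0:ℂ) 1) : ∃ k : H2,
    (∀ n, k n = (starRingEnd ℂ z) ^ n) ∧
    ∀ f : H2, HasSum (fun n => f n * z ^ n) (inner ℂ k f) := by
  have hz' : ‖z‖ < 1 := by simpa using hz
  have hm : Memℓp (fun n : ℕ => (starRingEnd ℂ z) ^ n) 2 := by
    apply memℓp_gen
    simp only [norm_pow, RCLike.norm_conj, ENNReal.toReal_ofNat, Real.rpow_ofNat]
    have : ∀ n : ℕ, (‖z‖ ^ n) ^ 2 = (‖z‖ ^ 2) ^ n := fun n => by ring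
    simp_rw [this]
    exact summable_geometric_of_lt_one (by positivity) (by nlinarith [norm_nonneg z])
  refine ⟨⟨_, hm⟩, fun n => rfl, fun f => ?_⟩
  have := lp.hasSum_inner (𝕜 := ℂ) (⟨_, hm⟩ : H2) f
  convert! this using 2 with n
  simp [mul_comm]

lemma hasSum_eval (f : H2) {z : ℂ} (hz : z ∈ ball (0:ℂ) 1) :
    HasSum (fun n => f n * z ^ n) (H2.eval f z) := by
  obtain ⟨k, -, hk⟩ := exists_ker z hz
  exact (hk f).summable.hasSum

lemma exists_evalL (z : ℂ) (hz : z ∈ ball (0:ℂ) 1) : ∃ L : H2 →L[ℂ] ℂ,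
    ∀ f : H2, L f = H2.eval f z := by
  obtain ⟨k, -, hk⟩ := exists_ker z hz
  exact ⟨innerSL ℂ k, fun f => ((hk f).unique (hasSum_eval f hz))⟩

lemma eval_hasSum {g : H2} {a : ℕ → ℂ} {v : ℕ → H2} (h : HasSum (fun n => a n • v n) g)
    {z : ℂ} (hz : z ∈ ball (0:ℂ) 1) : HasSum (fun n => a n * H2.eval (v n) z) (H2.eval g z) := by
  obtain ⟨L, hL⟩ := exists_evalL z hz
  have := h.mapL L
  simp only [map_smul] at this
  simpa only [hL, smul_eq_mul] using this

lemma exists_diag (c : ℕ → ℂ) (hc : ∀ n, ‖c n‖ ≤ 1) (f : H2) :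
    ∃ g : H2, (∀ n, g n = c n * f n) ∧ ‖g‖ ≤ ‖f‖ := by
  have hle : ∀ n, ‖c n * f n‖ ≤ ‖f n‖ := fun n => by
    rw [norm_mul]; exact mul_le_of_le_one_left (norm_nonneg _) (hc n)
  have hm : Memℓp (fun n : ℕ => c n * f n) 2 := by
    apply memℓp_gen
    refine Summable.of_nonneg_of_le (fun n => by positivity) (fun n => ?_)
      ((lp.memℓp f).summable (by simp))
    gcongr
    exact hle n
  refine ⟨⟨_, hm⟩, fun n => rfl, ?_⟩
  exact lp.norm_mono (by simp) hle

lemma parseval (f : H2) (r : ℝ) (hr0 : 0 ≤ r) (hr : r < 1) (c : H2)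
    (hc : ∀ n, c n = (r:ℂ) ^ n * f n) :
    ∃ F : C(UnitAddCircle, ℂ), (∀ x, F x = H2.eval f (r * AddCircle.toCircle x)) ∧
      ‖ContinuousMap.toLp (E := ℂ) 2 AddCircle.haarAddCircle ℂ F‖ = ‖c‖ := by
  have hs : Summable (fun n : ℕ => c n • (fourier (n:ℤ) : C(UnitAddCircle, ℂ))) := by
    apply Summable.of_norm
    simp only [norm_smul, fourier_norm, mul_one, hc]
    have := (hasSum_eval f (z := r) (by simp [abs_of_nonneg hr0, hr])).summable.norm
    simpa [mul_comm] using this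
  obtain ⟨V, hV⟩ := exists_isom (fun n : ℕ => fourierLp (T := 1) 2 (n:ℤ))
    (orthonormal_fourier.comp _ Nat.cast_injective)
  refine ⟨∑' n : ℕ, c n • (fourier (n:ℤ) : C(UnitAddCircle, ℂ)), fun x => ?_, ?_⟩
  · have h1 := hs.hasSum.mapL (ContinuousMap.evalCLM ℂ x)
    have h2 := hasSum_eval f (z := r * AddCircle.toCircle x) (by
      rw [mem_ball_zero_iff, norm_mul, Circle.norm_coe, mul_one, Complex.norm_real,
        Real.norm_of_nonneg hr0]
      exact hr)
    refine h1.unique ?_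
    convert h2 using 2 with n
    simp [hc, mul_pow, AddCircle.toCircle_nsmul]
    ring
  · have h1 := hs.hasSum.mapL (ContinuousMap.toLp (E := ℂ) 2 (AddCircle.haarAddCircle (T := 1)) ℂ)
    have h2 := h1.unique (by simpa using hV c)
    rw [h2, V.norm_map]

lemma mult_bound (f g : H2) (h : ℂ → ℂ) (M : ℝ) (hM : 0 ≤ M)
    (hb : ∀ z ∈ ball (0:ℂ) 1, ‖h z‖ ≤ M)
    (he : ∀ z ∈ ball (0:ℂ) 1, H2.eval g z = h z * H2.eval f z) : ‖g‖ ≤ M * ‖f‖ := by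
  have hr : ∀ n : ℕ, 0 ≤ (1 - 1 / ((n:ℝ) + 1)) ∧ (1 - 1 / ((n:ℝ) + 1)) < 1 := fun n => by
    have : 0 < 1 / ((n:ℝ) + 1) := by positivity
    have : 1 / ((n:ℝ) + 1) ≤ 1 := by
      rw [div_le_one (by positivity)]; linarith [(Nat.cast_nonneg n : (0:ℝ) ≤ n)]
    constructor <;> linarith
  set r : ℕ → ℝ := fun n => 1 - 1 / ((n:ℝ) + 1) with hrdef
  have hrn : ∀ n k : ℕ, ‖((r n : ℂ)) ^ k‖ ≤ 1 := fun n k => by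
    rw [norm_pow]; apply pow_le_one₀ (norm_nonneg _)
    rw [Complex.norm_real, Real.norm_of_nonneg (hr n).1]; exact (hr n).2.le
  choose cf hcf hcf' using fun n => exists_diag (fun k => (r n : ℂ) ^ k) (hrn n) f
  choose cg hcg hcg' using fun n => exists_diag (fun k => (r n : ℂ) ^ k) (hrn n) g
  have key : ∀ n, ‖cg n‖ ≤ M * ‖f‖ := fun n => by
    obtain ⟨F, hF, hF'⟩ := parseval f (r n) (hr n).1 (hr n).2 (cf n) (hcf n)
    obtain ⟨G, hG, hG'⟩ := parseval g (r n) (hr n).1 (hr n).2 (cg n) (hcg n)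
    refine le_trans ?_ (mul_le_mul_of_nonneg_left (hcf' n) hM)
    rw [← hF', ← hG']
    apply MeasureTheory.Lp.norm_le_mul_norm_of_ae_le_mul
    filter_upwards [ContinuousMap.coeFn_toLp (p := 2) (𝕜 := ℂ) AddCircle.haarAddCircle F,
      ContinuousMap.coeFn_toLp (p := 2) (𝕜 := ℂ) AddCircle.haarAddCircle G] with x h1 h2
    rw [h1, h2, hF, hG]
    have hx : (r n : ℂ) * AddCircle.toCircle x ∈ ball (0:ℂ) 1 := by
      rw [mem_ball_zero_iff, norm_mul, Circle.norm_coe, mul_one, Complex.norm_real,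
        Real.norm_of_nonneg (hr n).1]
      exact (hr n).2
    rw [he _ hx, norm_mul]
    gcongr
    exact hb _ hx
  refine lp.norm_le_of_tendsto (l := atTop) (F := cg) (Eventually.of_forall key) ?_
  rw [tendsto_pi_nhds]
  intro k
  have h1 : Tendsto r atTop (𝓝 1) := by
    simpa [hrdef] using (tendsto_const_nhds (x := (1:ℝ))).sub tendsto_one_div_add_atTop_nhds_zero_nat
  have h2 : Tendsto (fun n => (r n : ℂ) ^ k * g k) atTop (𝓝 (((1:ℝ):ℂ) ^ k * g k)) :=
    (((continuous_ofReal.tendsto 1).comp h1).pow k).mul_const _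
  simpa [hcg] using h2

lemma eval_inj {f g : H2} (h : ∀ z ∈ ball (0:ℂ) 1, H2.eval f z = H2.eval g z) : f = g := by
  have := mult_bound f (f - g) (fun _ => 0) 0 le_rfl (by simp) (fun z hz => by
    obtain ⟨L, hL⟩ := exists_evalL z hz
    rw [← hL, map_sub, hL, hL, h z hz]; simp)
  rw [zero_mul] at this
  exact sub_eq_zero.1 (norm_le_zero_iff.1 this)

lemma coeff_one {g : H2} {h : ℂ → ℂ} (hh : ContinuousAt h 0)
    (he : ∀ z ∈ ball (0:ℂ) 1, H2.eval g z = h z * z) : g 1 = h 0 := by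
  have hps : HasFPowerSeriesAt (H2.eval g) (FormalMultilinearSeries.ofScalars ℂ (fun n => g n)) 0 := by
    rw [hasFPowerSeriesAt_iff]
    filter_upwards [ball_mem_nhds (0:ℂ) one_pos] with z hz
    simpa [mul_comm] using hasSum_eval g hz
  have hd := hps.hasDerivAt
  rw [hasDerivAt_iff_tendsto_slope] at hd
  have h2 : Tendsto h (𝓝[≠] 0) (𝓝 (h 0)) := hh.mono_left nhdsWithin_le_nhds
  have h3 := tendsto_nhds_unique (h2.congr' ?_) hd
  · rw [h3]; simp
  · have : ∀ᶠ z in 𝓝[≠] (0:ℂ), z ∈ ball (0:ℂ) 1 :=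
      nhdsWithin_le_nhds (ball_mem_nhds (0:ℂ) one_pos)
    filter_upwards [this, self_mem_nhdsWithin] with z hz hz0
    rw [slope_def_field, he z hz, he 0 (by simp)]
    have : z ≠ 0 := hz0
    field_simp
    simp

lemma eval_single (n : ℕ) (a : ℂ) (z : ℂ) : H2.eval (lp.single 2 n a) z = a * z ^ n := by
  rw [H2.eval, tsum_eq_single n]
  · simp
  · intro b hb; simp [hb]

noncomputable def tau (a z : ℂ) : ℂ := (a - z) / (1 - starRingEnd ℂ a * z)

lemma tau_den {a z : ℂ} (ha : ‖a‖ < 1) (hz : ‖z‖ ≤ 1) : 1 - starRingEnd ℂ a * z ≠ 0 := by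
  intro h
  have h1 : starRingEnd ℂ a * z = 1 := (sub_eq_zero.1 h).symm
  have h2 : ‖a‖ * ‖z‖ = 1 := by
    rw [← RCLike.norm_conj a, ← norm_mul, h1, norm_one]
  nlinarith [norm_nonneg a, norm_nonneg z]

lemma tau_sq (a z : ℂ) : ‖1 - starRingEnd ℂ a * z‖ ^ 2 - ‖a - z‖ ^ 2 =
    (1 - ‖a‖ ^ 2) * (1 - ‖z‖ ^ 2) := by
  simp only [← Complex.normSq_eq_norm_sq, Complex.normSq_apply]
  simp
  ring

lemma tau_norm_lt {a z : ℂ} (ha : ‖a‖ < 1) (hz : ‖z‖ < 1) : ‖tau a z‖ < 1 := by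
  have h0 := norm_pos_iff.2 (tau_den ha hz.le)
  rw [tau, norm_div, div_lt_one h0]
  have := tau_sq a z
  have h1 : 0 < (1 - ‖a‖ ^ 2) * (1 - ‖z‖ ^ 2) :=
    mul_pos (by nlinarith [norm_nonneg a]) (by nlinarith [norm_nonneg z])
  exact lt_of_pow_lt_pow_left₀ 2 h0.le (by linarith)

lemma tau_norm_le {a z : ℂ} (ha : ‖a‖ < 1) (hz : ‖z‖ ≤ 1) : ‖tau a z‖ ≤ 1 := by
  have h0 := norm_pos_iff.2 (tau_den ha hz)
  rw [tau, norm_div, div_le_one h0]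
  have := tau_sq a z
  have h1 : 0 ≤ (1 - ‖a‖ ^ 2) * (1 - ‖z‖ ^ 2) :=
    mul_nonneg (by nlinarith [norm_nonneg a]) (by nlinarith [norm_nonneg z])
  exact (sq_le_sq₀ (norm_nonneg _) h0.le).1 (by linarith)

lemma tau_tau {a z : ℂ} (ha : ‖a‖ < 1) (hz : ‖z‖ < 1) : tau a (tau a z) = z := by
  have h0 := tau_den ha hz.le
  have h1 := tau_den ha (tau_norm_lt ha hz).le
  have h2 := tau_den ha ha.le
  rw [tau, div_eq_iff h1]
  rw [mul_comm] at h0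
  unfold tau
  rw [mul_comm (starRingEnd ℂ a) z]
  field_simp
  ring

lemma tau_diff {a z : ℂ} (ha : ‖a‖ < 1) (hz : ‖z‖ ≤ 1) : DifferentiableAt ℂ (tau a) z := by
  unfold tau
  have := tau_den ha hz
  fun_prop (disch := assumption)

lemma exists_shift : ∃ S : H2 →ₗᵢ[ℂ] H2, ∀ f : H2, ∀ z ∈ ball (0:ℂ) 1,
    H2.eval (S f) z = z * H2.eval f z := by
  obtain ⟨S, hS⟩ := exists_isom (E := H2) (fun n => lp.single 2 (n + 1) (1:ℂ)) (by
    rw [orthonormal_iff_ite]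
    intro i j
    rw [lp.inner_single_left]
    simp [Pi.single_apply])
  refine ⟨S, fun f z hz => ?_⟩
  refine (eval_hasSum (hS f) hz).unique ?_
  convert! (hasSum_eval f hz).mul_left z using 2 with n
  rw [eval_single]; ring

lemma exists_B (a : ℂ) (ha : ‖a‖ < 1) : ∃ (A : H2 →L[ℂ] H2) (B : H2 →ₗᵢ[ℂ] H2),
    (∀ f : H2, ∀ z ∈ ball (0:ℂ) 1, H2.eval (A f) z = (1 - starRingEnd ℂ a * z) * H2.eval f z) ∧
    (∀ f : H2, ∀ z ∈ ball (0:ℂ) 1, H2.eval (B f) z = tau a z * H2.eval f z) := by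
  obtain ⟨S, hS⟩ := exists_shift
  have ht : ‖starRingEnd ℂ a • S.toContinuousLinearMap‖ < 1 := by
    rw [norm_smul, RCLike.norm_conj]
    have := S.norm_toContinuousLinearMap_le
    nlinarith [norm_nonneg a]
  set U := Units.oneSub _ ht with hU
  have hUv : ∀ f : H2, (U : H2 →L[ℂ] H2) f = f - starRingEnd ℂ a • S f := fun f => by
    simp [hU]
  set B : H2 →L[ℂ] H2 := (a • (1 : H2 →L[ℂ] H2) - S.toContinuousLinearMap) *
    ((U⁻¹ : (H2 →L[ℂ] H2)ˣ) : H2 →L[ℂ] H2) with hB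
  have hBU : ∀ g : H2, B ((U : H2 →L[ℂ] H2) g) = a • g - S g := fun g => by
    have : ((U⁻¹ : (H2 →L[ℂ] H2)ˣ) : H2 →L[ℂ] H2) ((U : H2 →L[ℂ] H2) g) = g := by
      rw [← mul_apply_eq_comp, Units.inv_mul]; rfl
    rw [hB, mul_apply_eq_comp, this]; simp
  have hsurj : ∀ f : H2, ∃ g : H2, f = (U : H2 →L[ℂ] H2) g := fun f =>
    ⟨((U⁻¹ : (H2 →L[ℂ] H2)ˣ) : H2 →L[ℂ] H2) f, by
      rw [← mul_apply_eq_comp, Units.mul_inv]; rfl⟩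
  have hUe : ∀ f : H2, ∀ z ∈ ball (0:ℂ) 1,
      H2.eval ((U : H2 →L[ℂ] H2) f) z = (1 - starRingEnd ℂ a * z) * H2.eval f z := by
    intro f z hz
    obtain ⟨L, hL⟩ := exists_evalL z hz
    rw [hUv, ← hL, map_sub, map_smul, hL, hL, hS f z hz, smul_eq_mul]
    ring
  refine ⟨U, ⟨B.toLinearMap, fun f => ?_⟩, hUe, fun f z hz => ?_⟩
  · obtain ⟨g, rfl⟩ := hsurj f
    change ‖B _‖ = _
    rw [hBU, hUv]
    refine (sq_eq_sq₀ (norm_nonneg _) (norm_nonneg _)).1 ?_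
    rw [@norm_sub_sq ℂ, @norm_sub_sq ℂ, inner_smul_left, inner_smul_right, norm_smul, norm_smul,
      S.norm_map, RCLike.norm_conj]
    ring
  · obtain ⟨g, rfl⟩ := hsurj f
    change H2.eval (B _) z = _
    obtain ⟨L, hL⟩ := exists_evalL z hz
    rw [hBU, hUe g z hz, ← hL, map_sub, map_smul, hL, hL, hS g z hz, smul_eq_mul, tau]
    have := tau_den ha (z := z) (by simpa using (mem_ball_zero_iff.1 hz).le)
    rw [mul_comm (starRingEnd ℂ a) z] at *
    field_simp

lemma exists_C (a : ℂ) (ha : ‖a‖ < 1) : ∃ C : H2 →L[ℂ] H2,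
    ∀ f : H2, ∀ z ∈ ball (0:ℂ) 1, H2.eval (C f) z = H2.eval f (tau a z) := by
  obtain ⟨A, B, hA, hB⟩ := exists_B a ha
  obtain ⟨k, hk, hk'⟩ := exists_ker a (by simpa using ha)
  have hBn : ∀ (n : ℕ) (f : H2), ∀ z ∈ ball (0:ℂ) 1,
      H2.eval (B^[n] f) z = tau a z ^ n * H2.eval f z := by
    intro n f z hz
    induction n with
    | zero => simp
    | succ n ih => rw [Function.iterate_succ_apply', hB _ z hz, ih]; ring
  have hBnorm : ∀ (n : ℕ) (f : H2), ‖B^[n] f‖ = ‖f‖ := by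
    intro n f
    induction n with
    | zero => simp
    | succ n ih => rw [Function.iterate_succ_apply', B.norm_map, ih]
  have hBin : ∀ (n : ℕ) (f g : H2), inner ℂ (B^[n] f) (B^[n] g) = inner ℂ f g := by
    intro n f g
    induction n with
    | zero => simp
    | succ n ih => rw [Function.iterate_succ_apply', Function.iterate_succ_apply',
        B.inner_map_map, ih]
  have hk0 : k ≠ 0 := by
    intro h; have := hk 0; rw [h] at this; simp at this
  have hkn : (‖k‖ : ℂ) ≠ 0 := by simpa using hk0
  have hort : ∀ m n : ℕ, m < n → inner ℂ (B^[m] k) (B^[n] k) = 0 := by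
    intro m n hmn
    obtain ⟨j, rfl⟩ := Nat.exists_eq_add_of_lt hmn
    rw [add_assoc, Function.iterate_add_apply, hBin]
    have hab : a ∈ ball (0:ℂ) 1 := by simpa using ha
    rw [(hk' _).unique (hasSum_eval _ hab), hBn _ _ _ hab]
    simp [tau]
  have hv : Orthonormal ℂ (fun n : ℕ => (‖k‖ : ℂ)⁻¹ • B^[n] k) := by
    refine ⟨fun n => ?_, fun m n hmn => ?_⟩
    · rw [norm_smul, hBnorm, norm_inv, Complex.norm_real, norm_norm]
      exact inv_mul_cancel₀ (by simpa using hk0)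
    · change inner ℂ ((‖k‖ : ℂ)⁻¹ • B^[m] k) ((‖k‖ : ℂ)⁻¹ • B^[n] k) = 0
      rw [inner_smul_left, inner_smul_right]
      rcases lt_or_gt_of_ne hmn with h | h
      · rw [hort m n h]; simp
      · rw [← inner_conj_symm, hort n m h]; simp
  obtain ⟨V, hV⟩ := exists_isom _ hv
  refine ⟨(‖k‖ : ℂ) • (A * V.toContinuousLinearMap), fun f z hz => ?_⟩
  have hzn : ‖z‖ < 1 := by simpa using hz
  have hke : H2.eval k z = (1 - starRingEnd ℂ a * z)⁻¹ := by
    rw [H2.eval]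
    simp_rw [hk, ← mul_pow]
    apply tsum_geometric_of_norm_lt_one
    rw [norm_mul, RCLike.norm_conj]; nlinarith [norm_nonneg a, norm_nonneg z]
  obtain ⟨L, hL⟩ := exists_evalL z hz
  have hVe := eval_hasSum (hV f) hz
  have h1 : H2.eval (V f) z = (‖k‖ : ℂ)⁻¹ * (1 - starRingEnd ℂ a * z)⁻¹ * H2.eval f (tau a z) := by
    refine hVe.unique ?_
    convert! (hasSum_eval f (z := tau a z) (by simpa using tau_norm_lt ha hzn)).mul_left
      ((‖k‖ : ℂ)⁻¹ * (1 - starRingEnd ℂ a * z)⁻¹) using 2 with n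
    rw [← hL, map_smul, hL, hBn _ _ _ hz, hke, smul_eq_mul]
    ring
  have h2 : H2.eval (((‖k‖ : ℂ) • (A * V.toContinuousLinearMap)) f) z =
      (‖k‖ : ℂ) * H2.eval (A (V f)) z := by
    rw [← hL, ← hL]
    exact map_smul L (‖k‖ : ℂ) (A (V f))
  rw [h2, hA _ z hz, h1]
  have := tau_den ha hzn.le
  rw [mul_comm (starRingEnd ℂ a) z] at *
  field_simp

lemma exists_log_ball {u : ℂ → ℂ} (hu : DifferentiableOn ℂ u (ball (0:ℂ) 1))
    (h0 : ∀ z ∈ ball (0:ℂ) 1, u z ≠ 0) :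
    ∃ g : ℂ → ℂ, DifferentiableOn ℂ g (ball (0:ℂ) 1) ∧ ∀ z ∈ ball (0:ℂ) 1, exp (g z) = u z := by
  have h1 : DifferentiableOn ℂ (fun z => deriv u z / u z) (ball (0:ℂ) 1) :=
    (hu.deriv isOpen_ball).div hu h0
  obtain ⟨g, hg0, hg⟩ := h1.isExactOn_ball.with_val_at 0 (log (u 0))
  refine ⟨g, fun z hz => (hg z hz).differentiableAt.differentiableWithinAt, fun z hz => ?_⟩
  have hd : ∀ z ∈ ball (0:ℂ) 1, HasDerivAt (fun z => u z * exp (-g z)) 0 z := by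
    intro z hz
    have hu' := (hu.differentiableAt (isOpen_ball.mem_nhds hz)).hasDerivAt
    have := hu'.mul (hg z hz).neg.cexp
    convert! this using 1
    have := h0 z hz
    field_simp
    ring
  have hc := isOpen_ball.is_const_of_deriv_eq_zero (convex_ball (0:ℂ) 1).isPreconnected
    (fun z hz => (hd z hz).differentiableAt.differentiableWithinAt)
    (fun z hz => (hd z hz).deriv) hz (mem_ball_self one_pos)
  rw [hg0, exp_neg, exp_neg, exp_log (h0 0 (mem_ball_self one_pos)),
    mul_inv_cancel₀ (h0 0 (mem_ball_self one_pos))] at hc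
  exact ((mul_inv_eq_one₀ (exp_ne_zero _)).1 hc).symm

lemma ergodic_avg {g : ℂ → ℂ} (hg : DifferentiableOn ℂ g (ball (0:ℂ) 1)) {lam : ℂ}
    (hl : ‖lam‖ = 1) (hroot : ∀ n : ℕ, 0 < n → lam ^ n ≠ 1) (r : ℝ) (hr0 : 0 ≤ r) (hr : r < 1) :
    ∃ E : ℕ → ℝ, Tendsto E atTop (𝓝 0) ∧ ∀ n : ℕ, ∀ z ∈ ball (0:ℂ) 1,
      ‖∑ k ∈ Finset.range n, g (r * (lam ^ k * z)) - n * g 0‖ ≤ n * E n := by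
  obtain ⟨a, ha⟩ : ∃ a : ℕ → ℂ, ∀ y ∈ ball (0:ℂ) 1, HasSum (fun j => a j * y ^ j) (g y) := by
    refine ⟨fun j => ((j.factorial : ℂ))⁻¹ * iteratedDeriv j g 0, fun y hy => ?_⟩
    have := Complex.hasSum_taylorSeries_on_ball hg hy
    convert! this using 2 with j
    simp
    ring
  have ha0 : a 0 = g 0 := by
    refine HasSum.unique ?_ (ha 0 (mem_ball_self one_pos))
    convert! hasSum_ite_eq 0 (a 0) using 2 with j
    split_ifs with h
    · simp [h]
    · simp [h]
  have hsum : Summable (fun j => ‖a j‖ * r ^ j) := by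
    have := (ha r (by simp [abs_of_nonneg hr0, hr])).summable.norm
    simpa [abs_of_nonneg hr0] using this
  have hs1 : ∀ n j : ℕ, ‖∑ k ∈ Finset.range n, (lam ^ j) ^ k‖ ≤ n := fun n j => by
    refine (norm_sum_le _ _).trans ?_
    simp [hl]
  set d : ℕ → ℕ → ℝ := fun n j => if j = 0 then 0 else
    ‖a j‖ * r ^ j * (‖∑ k ∈ Finset.range n, (lam ^ j) ^ k‖ / n) with hd
  have hd0 : ∀ n j, 0 ≤ d n j := fun n j => by
    simp only [hd]; split_ifs <;> positivity
  have hdle : ∀ n j, d n j ≤ ‖a j‖ * r ^ j := fun n j => by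
    simp only [hd]; split_ifs
    · positivity
    · exact mul_le_of_le_one_right (by positivity) (div_le_one_of_le₀ (hs1 n j) (by positivity))
  refine ⟨fun n => ∑' j, d n j, ?_, fun n z hz => ?_⟩
  · have : Tendsto (fun n => ∑' j, d n j) atTop (𝓝 (∑' _ : ℕ, (0:ℝ))) := by
      refine tendsto_tsum_of_dominated_convergence hsum (fun j => ?_)
        (Eventually.of_forall fun n j => ?_)
      · simp only [hd]
        split_ifs with hj
        · exact tendsto_const_nhds
        · have hne : lam ^ j ≠ 1 := hroot j (Nat.pos_of_ne_zero hj)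
          have hb : ∀ n : ℕ, ‖∑ k ∈ Finset.range n, (lam ^ j) ^ k‖ ≤ 2 / ‖lam ^ j - 1‖ := fun n => by
            rw [geom_sum_eq hne, norm_div]
            gcongr
            refine (norm_sub_le _ _).trans ?_
            simp [hl]; norm_num
          have h1 : Tendsto (fun n : ℕ => ‖∑ k ∈ Finset.range n, (lam ^ j) ^ k‖ / n) atTop (𝓝 0) := by
            refine squeeze_zero (fun n => by positivity)
              (fun n => div_le_div_of_nonneg_right (hb n) (Nat.cast_nonneg n)) ?_
            exact tendsto_const_div_atTop_nhds_zero_nat _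
          simpa using h1.const_mul (‖a j‖ * r ^ j)
      · rw [Real.norm_of_nonneg (hd0 n j)]; exact hdle n j
    simpa using this
  · rcases Nat.eq_zero_or_pos n with rfl | hn
    · simp
    have hzn : ‖z‖ < 1 := by simpa using hz
    have hmem : ∀ k : ℕ, (r:ℂ) * (lam ^ k * z) ∈ ball (0:ℂ) 1 := fun k => by
      rw [mem_ball_zero_iff, norm_mul, norm_mul, norm_pow, hl, one_pow, one_mul,
        Complex.norm_real, Real.norm_of_nonneg hr0]
      nlinarith [norm_nonneg z]
    have h1 := hasSum_sum (s := Finset.range n) (fun k _ => ha _ (hmem k))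
    have h2 := h1.sub (hasSum_ite_eq 0 ((n:ℂ) * g 0))
    have hds : Summable (d n) := Summable.of_nonneg_of_le (hd0 n) (hdle n) hsum
    refine HasSum.norm_le_of_bounded h2 (hds.hasSum.mul_left (n:ℝ)) (fun j => ?_)
    by_cases hj : j = 0
    · simp [hj, hd, ha0]
    · simp only [hj, hd, if_false, sub_zero]
      have e1 : ∑ k ∈ Finset.range n, a j * ((r:ℂ) * (lam ^ k * z)) ^ j =
          a j * r ^ j * z ^ j * ∑ k ∈ Finset.range n, (lam ^ j) ^ k := by
        rw [Finset.mul_sum]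
        refine Finset.sum_congr rfl fun k _ => ?_
        rw [mul_pow, mul_pow, ← pow_mul, ← pow_mul, mul_comm k j]; ring
      have hn' : (n:ℝ) ≠ 0 := by positivity
      rw [e1, norm_mul, norm_mul, norm_mul, norm_pow, norm_pow, Complex.norm_real,
        Real.norm_of_nonneg hr0]
      have e2 : (n:ℝ) * (‖a j‖ * r ^ j * (‖∑ k ∈ Finset.range n, (lam ^ j) ^ k‖ / n)) =
        ‖a j‖ * r ^ j * 1 * ‖∑ k ∈ Finset.range n, (lam ^ j) ^ k‖ := by field_simp
      rw [e2]
      gcongr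
      exact pow_le_one₀ (norm_nonneg _) hzn.le

lemma prod_bound {u : ℂ → ℂ} (hc : ContinuousOn u (closedBall (0:ℂ) 1))
    (hu : DifferentiableOn ℂ u (ball (0:ℂ) 1)) {ε : ℝ} (hε : 0 < ε)
    (hlow : ∀ z ∈ ball (0:ℂ) 1, ε ≤ ‖u z‖) {lam : ℂ}
    (hl : ‖lam‖ = 1) (hroot : ∀ n : ℕ, 0 < n → lam ^ n ≠ 1) (h1 : ‖u 0‖ < 1) :
    ∃ b : ℕ → ℝ, Tendsto b atTop (𝓝 0) ∧ ∀ n : ℕ, ∀ z ∈ ball (0:ℂ) 1,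
      ‖∏ k ∈ Finset.range n, u (lam ^ k * z)‖ ≤ b n := by
  have hne : ∀ z ∈ ball (0:ℂ) 1, u z ≠ 0 := fun z hz =>
    norm_pos_iff.1 (hε.trans_le (hlow z hz))
  have h00 : (0:ℂ) ∈ ball (0:ℂ) 1 := mem_ball_self one_pos
  obtain ⟨g, hg, hge⟩ := exists_log_ball hu hne
  have hlog : Real.exp (g 0).re = ‖u 0‖ := by rw [← Complex.norm_exp, hge 0 h00]
  have hneg : (g 0).re < 0 := by
    rw [← Real.exp_lt_one_iff, hlog]; exact h1
  set η : ℝ := -(g 0).re / 2 with hη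
  have hηpos : 0 < η := by rw [hη]; linarith
  have huc := (isCompact_closedBall (0:ℂ) 1).uniformContinuousOn_of_continuous hc
  obtain ⟨δ, hδ, huc'⟩ := Metric.uniformContinuousOn_iff.1 huc (ε * η) (by positivity)
  obtain ⟨r, hr0, hr, hrδ⟩ : ∃ r : ℝ, 0 ≤ r ∧ r < 1 ∧ 1 - r < δ := by
    refine ⟨max 0 (1 - δ / 2), le_max_left _ _, max_lt one_pos (by linarith), ?_⟩
    have := le_max_right 0 (1 - δ / 2)
    linarith
  have hcomp : ∀ z ∈ ball (0:ℂ) 1, ‖u z‖ ≤ Real.exp (η + (g (r * z)).re) := by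
    intro z hz
    have hzn : ‖z‖ < 1 := by simpa using hz
    have hrz : (r:ℂ) * z ∈ ball (0:ℂ) 1 := by
      rw [mem_ball_zero_iff, norm_mul, Complex.norm_real, Real.norm_of_nonneg hr0]
      nlinarith [norm_nonneg z]
    have hdist : dist z (r * z) < δ := by
      have : z - r * z = ((1 - r : ℝ) : ℂ) * z := by push_cast; ring
      rw [dist_eq_norm, this, norm_mul, Complex.norm_real, Real.norm_of_nonneg (by linarith)]
      nlinarith [norm_nonneg z]
    have h2 := huc' z (ball_subset_closedBall hz) _ (ball_subset_closedBall hrz) hdist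
    rw [dist_eq_norm] at h2
    have h3 : ‖u z‖ ≤ ‖u (r * z)‖ + ‖u z - u (r * z)‖ := norm_le_insert' _ _
    have h4 := hlow _ hrz
    have h5 : ‖u z‖ ≤ (η + 1) * ‖u (r * z)‖ := by nlinarith
    rw [Real.exp_add, ← Complex.norm_exp, hge _ hrz]
    exact h5.trans (mul_le_mul_of_nonneg_right (Real.add_one_le_exp η) (norm_nonneg _))
  obtain ⟨E, hE, hE'⟩ := ergodic_avg hg hl hroot r hr0 hr
  refine ⟨fun n => Real.exp (n * (η + (g 0).re + E n)), ?_, fun n z hz => ?_⟩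
  · refine Real.tendsto_exp_atBot.comp ?_
    have h2 : Tendsto (fun n => η + (g 0).re + E n) atTop (𝓝 (η + (g 0).re + 0)) :=
      hE.const_add _
    exact tendsto_natCast_atTop_atTop.atTop_mul_neg (by rw [hη]; linarith) h2
  · rw [norm_prod]
    have hmem : ∀ k : ℕ, lam ^ k * z ∈ ball (0:ℂ) 1 := fun k => by
      rw [mem_ball_zero_iff, norm_mul, norm_pow, hl, one_pow, one_mul]; simpa using hz
    refine (Finset.prod_le_prod (fun _ _ => norm_nonneg _) (fun k _ => hcomp _ (hmem k))).trans ?_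
    rw [← Real.exp_sum, Real.exp_le_exp, Finset.sum_add_distrib, ← Complex.re_sum]
    have h2 := (Complex.re_le_norm _).trans (hE' n z hz)
    have h3 : ((n:ℂ) * g 0).re = n * (g 0).re := by simp
    rw [Complex.sub_re, h3] at h2
    simp only [Finset.sum_const, Finset.card_range, nsmul_eq_mul]
    linarith

lemma pow_conv {c l : ℂ} (h : Tendsto (fun n : ℕ => c ^ n) atTop (𝓝 l)) (hc : 1 ≤ ‖c‖) :
    c = 1 := by
  have h1 := ((tendsto_add_atTop_iff_nat 1).2 h).sub h
  rw [sub_self] at h1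
  have h2 : ‖c - 1‖ ≤ 0 := by
    refine ge_of_tendsto' (by simpa using h1.norm) (fun n => ?_)
    have : c ^ (n+1) - c ^ n = c ^ n * (c - 1) := by ring
    rw [this, norm_mul, norm_pow]
    exact le_mul_of_one_le_left (norm_nonneg _) (one_le_pow₀ hc)
  exact sub_eq_zero.1 (norm_le_zero_iff.1 h2)

lemma core {u : ℂ → ℂ} (hc : ContinuousOn u (closedBall (0:ℂ) 1))
    (hu : DifferentiableOn ℂ u (ball (0:ℂ) 1)) {ε : ℝ} (hε : 0 < ε)
    (hlow : ∀ z ∈ ball (0:ℂ) 1, ε ≤ ‖u z‖) {lam : ℂ}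
    (hl : ‖lam‖ = 1) (hroot : ∀ n : ℕ, 0 < n → lam ^ n ≠ 1) (S : H2 →L[ℂ] H2)
    (hS : ∀ f : H2, ∀ z ∈ ball (0:ℂ) 1, H2.eval (S f) z = u z * H2.eval f (lam * z)) :
    (∃ P : H2 →L[ℂ] H2, Tendsto (fun n : ℕ => S ^ n) atTop (𝓝 P)) ↔ ‖u 0‖ < 1 := by
  have h00 : (0:ℂ) ∈ ball (0:ℂ) 1 := mem_ball_self one_pos
  have hmem : ∀ z ∈ ball (0:ℂ) 1, ∀ k : ℕ, lam ^ k * z ∈ ball (0:ℂ) 1 := fun z hz k => by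
    rw [mem_ball_zero_iff, norm_mul, norm_pow, hl, one_pow, one_mul]; simpa using hz
  have hSn : ∀ (n : ℕ) (f : H2), ∀ z ∈ ball (0:ℂ) 1, H2.eval ((S ^ n) f) z =
      (∏ k ∈ Finset.range n, u (lam ^ k * z)) * H2.eval f (lam ^ n * z) := by
    intro n
    induction n with
    | zero => intro f z hz; simp
    | succ n ih =>
      intro f z hz
      rw [pow_succ', mul_apply_eq_comp, hS _ z hz, ih f _ (by simpa using hmem z hz 1),
        Finset.prod_range_succ']
      simp only [pow_succ, pow_zero, one_mul, mul_assoc]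
      ring
  constructor
  · rintro ⟨P, hP⟩
    by_contra hlt
    push Not at hlt
    have hev : ∀ f : H2, Tendsto (fun n => (S ^ n) f) atTop (𝓝 (P f)) := fun f =>
      ((ContinuousLinearMap.apply ℂ H2 f).continuous.tendsto P).comp hP
    have hw : u 0 = 1 := by
      obtain ⟨L, hL⟩ := exists_evalL 0 h00
      have h1 := (L.continuous.tendsto _).comp (hev (lp.single 2 0 (1:ℂ)))
      refine pow_conv (h1.congr fun n => ?_) hlt
      simp only [Function.comp_apply, hL]
      rw [hSn n _ 0 h00, eval_single]; simp
    have hlam : lam = 1 := by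
      have h1 := ((lp.lipschitzWith_one_eval (E := fun _ : ℕ => ℂ) 2 1).continuous.tendsto _).comp
        (hev (lp.single 2 1 (1:ℂ)))
      refine pow_conv (h1.congr fun n => ?_) hl.ge
      simp only [Function.comp_apply]
      rw [coeff_one (h := fun z => (∏ k ∈ Finset.range n, u (lam ^ k * z)) * lam ^ n) ?_ ?_]
      · simp [hw]
      · refine ContinuousAt.mul ?_ continuousAt_const
        refine tendsto_finsetProd _ fun k _ => ?_
        have hu0 : ContinuousAt u (lam ^ k * 0) := by
          rw [mul_zero]
          exact (hu.differentiableAt (isOpen_ball.mem_nhds h00)).continuousAt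
        exact ContinuousAt.comp (g := u) (f := fun z => lam ^ k * z) hu0 (by fun_prop)
      · intro z hz
        rw [hSn n _ z hz, eval_single]; ring
    exact hroot 1 one_pos (by simpa using hlam)
  · intro h1
    obtain ⟨b, hb, hb'⟩ := prod_bound hc hu hε hlow hl hroot h1
    refine ⟨0, ?_⟩
    rw [tendsto_zero_iff_norm_tendsto_zero]
    refine squeeze_zero (fun n => norm_nonneg _) (fun n => ?_) hb
    have hb0 : 0 ≤ b n := (norm_nonneg _).trans (hb' n 0 h00)
    refine ContinuousLinearMap.opNorm_le_bound _ hb0 (fun f => ?_)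
    obtain ⟨g, hg, hg'⟩ := exists_diag (fun j => (lam ^ n) ^ j) (fun j => by simp [hl]) f
    refine (mult_bound g _ _ (b n) hb0 (hb' n) fun z hz => ?_).trans
      (mul_le_mul_of_nonneg_left hg' hb0)
    rw [hSn n f z hz]
    congr 1
    simp only [H2.eval, hg]
    refine tsum_congr fun j => ?_
    rw [mul_pow]; ring

lemma schwarz_rot {ρ σ : ℂ → ℂ} (hρ : DifferentiableOn ℂ ρ (ball (0:ℂ) 1))
    (hσ : DifferentiableOn ℂ σ (ball (0:ℂ) 1))
    (hρm : Set.MapsTo ρ (ball (0:ℂ) 1) (ball (0:ℂ) 1))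
    (hσm : Set.MapsTo σ (ball (0:ℂ) 1) (ball (0:ℂ) 1))
    (hinv : ∀ z ∈ ball (0:ℂ) 1, σ (ρ z) = z) (h0 : ρ 0 = 0) :
    ∃ lam : ℂ, ‖lam‖ = 1 ∧ ∀ z ∈ ball (0:ℂ) 1, ρ z = lam * z := by
  have h00 : (0:ℂ) ∈ ball (0:ℂ) 1 := mem_ball_self one_pos
  have hσ0 : σ 0 = 0 := by have := hinv 0 h00; rwa [h0] at this
  have hn : ∀ z ∈ ball (0:ℂ) 1, ‖ρ z‖ = ‖z‖ := fun z hz => by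
    refine le_antisymm (norm_le_norm_of_mapsTo_ball hρ (hρm.mono_right ball_subset_closedBall) h0
      (by simpa using hz)) ?_
    have := norm_le_norm_of_mapsTo_ball hσ (hσm.mono_right ball_subset_closedBall) hσ0
      (z := ρ z) (by simpa using hρm hz)
    rwa [hinv z hz] at this
  have hh : (1/2 : ℂ) ∈ ball (0:ℂ) 1 := by simp; norm_num
  obtain ⟨C, hC, hC'⟩ := affine_of_mapsTo_ball_of_exists_norm_dslope_eq_div' (R₂ := 1) hρ
    (by rw [h0]; exact hρm.mono_right ball_subset_closedBall) ⟨1/2, hh, by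
      rw [dslope_of_ne _ (by norm_num), slope_def_field, h0, norm_div, sub_zero, sub_zero, hn _ hh]
      norm_num⟩
  refine ⟨C, by simpa using hC, fun z hz => ?_⟩
  rw [hC' hz]; simp [h0, mul_comm]

theorem uniform_convergence_iff_of_elliptic_infinite_order
    (φ w : ℂ → ℂ)
    (hφ : DifferentiableOn ℂ φ (ball (0:ℂ) 1))
    (hφmaps : Set.MapsTo φ (ball (0:ℂ) 1) (ball (0:ℂ) 1))
    (haut : ∃ ψ : ℂ → ℂ, DifferentiableOn ℂ ψ (ball (0:ℂ) 1) ∧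
        Set.MapsTo ψ (ball (0:ℂ) 1) (ball (0:ℂ) 1) ∧
        (∀ z ∈ ball (0:ℂ) 1, ψ (φ z) = z) ∧ (∀ z ∈ ball (0:ℂ) 1, φ (ψ z) = z))
    (α : ℂ) (hα : α ∈ ball (0:ℂ) 1) (hfix : φ α = α)
    (hinford : ∀ n : ℕ, 0 < n → ∃ z ∈ ball (0:ℂ) 1, φ^[n] z ≠ z)
    (hwcont : ContinuousOn w (closedBall (0:ℂ) 1))
    (hwhol : DifferentiableOn ℂ w (ball (0:ℂ) 1))
    (hwbdd : ∃ ε : ℝ, 0 < ε ∧ ∀ z ∈ ball (0:ℂ) 1, ε ≤ ‖w z‖)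
    (T : H2 →L[ℂ] H2)
    (hT : ∀ (f : H2), ∀ z ∈ ball (0:ℂ) 1, H2.eval (T f) z = w z * H2.eval f (φ z))
    (hpb : ∃ C : ℝ, ∀ n : ℕ, ‖T ^ n‖ ≤ C) :
    (∃ P : H2 →L[ℂ] H2, Tendsto (fun n : ℕ => T ^ n) atTop (𝓝 P)) ↔ ‖w α‖ < 1 := by
  obtain ⟨ψ, hψ, hψmaps, hψφ, hφψ⟩ := haut
  obtain ⟨ε, hε, hlow⟩ := hwbdd
  have ha : ‖α‖ < 1 := by simpa using hα
  have h00 : (0:ℂ) ∈ ball (0:ℂ) 1 := mem_ball_self one_pos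
  have τm : Set.MapsTo (tau α) (ball (0:ℂ) 1) (ball (0:ℂ) 1) := fun z hz => by
    rw [mem_ball_zero_iff] at hz ⊢; exact tau_norm_lt ha hz
  have τm' : Set.MapsTo (tau α) (closedBall (0:ℂ) 1) (closedBall (0:ℂ) 1) := fun z hz => by
    rw [mem_closedBall_zero_iff] at hz ⊢; exact tau_norm_le ha hz
  have τd : DifferentiableOn ℂ (tau α) (ball (0:ℂ) 1) := fun z hz =>
    (tau_diff ha (mem_ball_zero_iff.1 hz).le).differentiableWithinAt
  have τc : ContinuousOn (tau α) (closedBall (0:ℂ) 1) := fun z hz =>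
    (tau_diff ha (mem_closedBall_zero_iff.1 hz)).continuousAt.continuousWithinAt
  have ττ : ∀ z ∈ ball (0:ℂ) 1, tau α (tau α z) = z := fun z hz =>
    tau_tau ha (mem_ball_zero_iff.1 hz)
  have τ0 : tau α 0 = α := by simp [tau]
  have τα : tau α α = 0 := by simp [tau]
  obtain ⟨lam, hl, hlam⟩ := schwarz_rot (ρ := fun z => tau α (φ (tau α z)))
    (σ := fun z => tau α (ψ (tau α z)))
    (τd.comp (hφ.comp τd τm) (hφmaps.comp τm)) (τd.comp (hψ.comp τd τm) (hψmaps.comp τm))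
    (τm.comp (hφmaps.comp τm)) (τm.comp (hψmaps.comp τm))
    (fun z hz => by
      change tau α (ψ (tau α (tau α (φ (tau α z))))) = z
      rw [ττ _ (hφmaps (τm hz)), hψφ _ (τm hz), ττ z hz])
    (by change tau α (φ (tau α 0)) = 0
        rw [τ0, hfix, τα])
  have hlm : ∀ z ∈ ball (0:ℂ) 1, ∀ n : ℕ, lam ^ n * z ∈ ball (0:ℂ) 1 := fun z hz k => by
    rw [mem_ball_zero_iff, norm_mul, norm_pow, hl, one_pow, one_mul]; simpa using hz
  have hφτ : ∀ z ∈ ball (0:ℂ) 1, φ (tau α z) = tau α (lam * z) := fun z hz => by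
    rw [← hlam z hz]; exact (ττ _ (hφmaps (τm hz))).symm
  have hiter : ∀ (n : ℕ), ∀ z ∈ ball (0:ℂ) 1, φ^[n] (tau α z) = tau α (lam ^ n * z) := by
    intro n z hz
    induction n with
    | zero => simp
    | succ n ih =>
      rw [Function.iterate_succ_apply', ih, hφτ _ (hlm z hz n), pow_succ', mul_assoc]
  have hroot : ∀ n : ℕ, 0 < n → lam ^ n ≠ 1 := by
    intro n hn h
    obtain ⟨z, hz, hne⟩ := hinford n hn
    apply hne
    have := hiter n _ (τm hz)
    rwa [ττ z hz, h, one_mul, ττ z hz] at this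
  obtain ⟨C, hC⟩ := exists_C α ha
  have hCC : C * C = 1 := by
    ext1 f
    refine eval_inj fun z hz => ?_
    rw [mul_apply_eq_comp, hC _ z hz, hC _ _ (τm hz), ττ z hz]; rfl
  have hconj : ∀ n : ℕ, (C * T * C) ^ n = C * T ^ n * C := by
    intro n
    induction n with
    | zero => simp [hCC]
    | succ n ih =>
      rw [pow_succ, ih, pow_succ]
      calc C * T ^ n * C * (C * T * C) = C * T ^ n * (C * C) * T * C := by noncomm_ring
        _ = _ := by rw [hCC]; noncomm_ring
  have hcore := core (u := w ∘ tau α) (hwcont.comp τc τm') (hwhol.comp τd τm) hε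
    (fun z hz => hlow _ (τm hz)) hl hroot (C * T * C) (fun f z hz => by
      rw [mul_apply_eq_comp, mul_apply_eq_comp, hC _ z hz, hT _ _ (τm hz), hφτ z hz,
        hC _ _ (τm (by simpa using hlm z hz 1)), ττ _ (by simpa using hlm z hz 1)]
      rfl)
  rw [Function.comp_apply, τ0] at hcore
  rw [← hcore]
  constructor
  · rintro ⟨P, hP⟩
    refine ⟨C * P * C, ?_⟩
    simp_rw [hconj]
    exact (hP.const_mul C).mul_const C
  · rintro ⟨P, hP⟩
    refine ⟨C * P * C, ?_⟩
    have := (hP.const_mul C).mul_const C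
    refine this.congr fun n => ?_
    rw [hconj]
    calc C * (C * T ^ n * C) * C = (C * C) * T ^ n * (C * C) := by noncomm_ring
      _ = _ := by rw [hCC]; noncomm_ring
end

section
/- Let φ: 𝔻 → 𝔻 be holomorphic and let w ∈ H² be such that T_{w,φ} defines a bounded operator on the Hardy space H². Then T_{w,φ} is an isometry on H² if and only if φ is inner, ‖w‖₂ = 1, and ⟨w, w·φⁿ⟩ = 0 in H² for all n ≥ 1. -/
open Complex Metric Filter Topology MeasureTheory

/-- A bounded holomorphic function on the unit disc is *inner* if its radial boundary
values have modulus one almost everywhere on the unit circle. -/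
def IsInnerFn (φ : ℂ → ℂ) : Prop :=
  DifferentiableOn ℂ φ (ball (0:ℂ) 1) ∧ (∀ z ∈ ball (0:ℂ) 1, ‖φ z‖ ≤ 1) ∧
    ∀ᵐ θ : ℝ, ∃ l : ℂ, ‖l‖ = 1 ∧
      Tendsto (fun r : ℝ => φ ((r : ℂ) * Complex.exp (θ * Complex.I)))
        (𝓝[<] (1:ℝ)) (𝓝 l)

lemma aux_deriv_repr (H : ℂ → ℂ) (hc : Continuous H) (hd : DifferentiableOn ℂ H (ball (0:ℂ) 1))
    (z : ℂ) (hz : z ∈ ball (0:ℂ) 1) :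
    ∮ ζ in C(0, 1), ((ζ - z)^2)⁻¹ * H ζ = (2 * Real.pi * I) * deriv H z := by
  have hdz : DifferentiableAt ℂ H z := hd.differentiableAt (isOpen_ball.mem_nhds hz)
  have hcd : ContinuousOn (dslope H z) (closedBall (0:ℂ) 1) := by
    rw [continuousOn_dslope (mem_of_superset (isOpen_ball.mem_nhds hz) ball_subset_closedBall)]
    exact ⟨hc.continuousOn, hdz⟩
  have hdd : DifferentiableOn ℂ (dslope H z) (ball (0:ℂ) 1) := by
    rw [Complex.differentiableOn_dslope (isOpen_ball.mem_nhds hz)]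
    exact hd
  have h1 := Complex.circleIntegral_sub_inv_smul_of_differentiable_on_off_countable
    (s := ∅) (Set.countable_empty) hz hcd
    (fun x hx => hdd.differentiableAt (isOpen_ball.mem_nhds hx.1))
  rw [dslope_same] at h1
  have hne : ∀ ζ ∈ sphere (0:ℂ) 1, ζ - z ≠ 0 := by
    intro ζ hζ h
    rw [sub_eq_zero] at h
    subst h
    simp at hζ hz
    linarith
  have h2 : ∮ ζ in C(0, 1), (ζ - z)^(-2:ℤ) = 0 :=
    circleIntegral.integral_sub_zpow_of_ne (by norm_num) _ _ _
  have h3 : (∮ ζ in C(0, 1), (ζ - z)⁻¹ • dslope H z ζ) =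
      ∮ ζ in C(0, 1), (((ζ - z)^2)⁻¹ * H ζ - H z * (ζ - z)^(-2:ℤ)) := by
    apply circleIntegral.integral_congr zero_le_one
    intro ζ hζ
    have := hne ζ hζ
    have hn : ζ ≠ z := fun h => this (by simp [h])
    simp only [dslope_of_ne _ hn, slope_def_field, smul_eq_mul]
    rw [zpow_neg]
    field_simp
  have hinv : ContinuousOn (fun ζ => ((ζ - z)^2)⁻¹) (sphere (0:ℂ) 1) := by
    apply ContinuousOn.inv₀ (by fun_prop)
    intro x hx
    exact pow_ne_zero _ (hne x hx)
  rw [h3, circleIntegral.integral_sub, circleIntegral.integral_const_mul, h2] at h1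
  · simpa using h1
  · apply ContinuousOn.circleIntegrable zero_le_one
    exact hinv.mul hc.continuousOn
  · apply ContinuousOn.circleIntegrable zero_le_one
    refine ((continuousOn_const (c := H z)).mul hinv).congr ?_
    intro x hx
    simp only [zpow_neg]
    norm_cast

lemma aux_zero_repr (H : ℂ → ℂ) (hc : Continuous H) (hd : DifferentiableOn ℂ H (ball (0:ℂ) 1))
    (z : ℂ) (hz : 1 < ‖z‖) :
    ∮ ζ in C(0, 1), ((ζ - z)^2)⁻¹ * H ζ = 0 := by
  have hne : ∀ ζ ∈ closedBall (0:ℂ) 1, (ζ - z)^2 ≠ 0 := by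
    intro ζ hζ h
    have h := pow_eq_zero_iff (two_ne_zero) |>.1 h
    rw [sub_eq_zero] at h
    subst h
    simp at hζ
    linarith
  apply DiffContOnCl.circleIntegral_eq_zero zero_le_one
  refine ⟨?_, ?_⟩
  · refine DifferentiableOn.mul (DifferentiableOn.inv (by fun_prop) ?_) hd
    intro x hx; exact hne x (ball_subset_closedBall hx)
  · rw [closure_ball _ one_ne_zero]
    exact ContinuousOn.mul (ContinuousOn.inv₀ (by fun_prop) hne) hc.continuousOn

lemma aux_poisson (z : ℂ) (hz : z ∈ ball (0:ℂ) 1) :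
    ∫ θ in (0:ℝ)..(2*Real.pi), (1 - ‖z‖^2) / ‖circleMap 0 1 θ - z‖^2 = 2 * Real.pi := by
  have h := (diffContOnCl_const (𝕜 := ℂ) (s := ball (0:ℂ) 1)
    (c := (1:ℂ))).circleAverage_poissonKernel_smul' hz
  rw [Real.circleAverage_def] at h
  simp only [sub_zero, norm_circleMap_zero, abs_one, one_pow, Complex.real_smul, mul_one] at h
  rw [intervalIntegral.integral_ofReal] at h
  norm_cast at h
  field_simp at h
  exact h

lemma aux_kernel (ζ ζ0 : ℂ) (r : ℝ) (hr : 0 < r) (hr1 : r < 1) (h : ‖ζ‖ = 1) (h0 : ‖ζ0‖ = 1) :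
    ‖((ζ - r * ζ0)^2)⁻¹ - ((ζ - r⁻¹ * ζ0)^2)⁻¹‖ ≤ 2 * (1 - r^2) / ‖ζ - r * ζ0‖^3 := by
  have hrc : (r:ℂ) ≠ 0 := by exact_mod_cast hr.ne'
  have key : ‖ζ - r⁻¹ * ζ0‖ = r⁻¹ * ‖ζ - r * ζ0‖ := by
    have e1 : ‖ζ - r * ζ0‖^2 = 1 + r^2 - 2 * r * (ζ * (starRingEnd ℂ) ζ0).re := by
      rw [← Complex.normSq_eq_norm_sq, Complex.normSq_sub]
      simp [Complex.normSq_eq_norm_sq, h, h0]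
      ring
    have e2 : ‖ζ - r⁻¹ * ζ0‖^2 = 1 + (r⁻¹)^2 - 2 * r⁻¹ * (ζ * (starRingEnd ℂ) ζ0).re := by
      rw [← Complex.normSq_eq_norm_sq, Complex.normSq_sub]
      simp [Complex.normSq_eq_norm_sq, h, h0, -Complex.ofReal_inv]
      ring
    have : ‖ζ - r⁻¹ * ζ0‖^2 = (r⁻¹ * ‖ζ - r * ζ0‖)^2 := by
      rw [mul_pow, e1, e2]; field_simp; ring
    exact (pow_left_inj₀ (norm_nonneg _) (by positivity) two_ne_zero).1 this
  have hpos : 0 < ‖ζ - r * ζ0‖ := by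
    have := norm_sub_norm_le ζ (r * ζ0)
    simp [h, h0, abs_of_pos hr] at this
    linarith
  set A := ζ - r * ζ0 with hA
  set B := ζ - r⁻¹ * ζ0 with hB
  have hBpos : 0 < ‖B‖ := by rw [key]; positivity
  have hA0 : A ≠ 0 := norm_pos_iff.1 hpos
  have hB0 : B ≠ 0 := norm_pos_iff.1 hBpos
  have e : (A^2)⁻¹ - (B^2)⁻¹ = (B - A) * (B + A) / (A^2 * B^2) := by
    field_simp; ring
  have hBA : ‖B - A‖ = r⁻¹ - r := by
    have : B - A = ((r - r⁻¹ : ℝ) : ℂ) * ζ0 := by simp [hA, hB]; ring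
    rw [this, norm_mul, h0, Complex.norm_real, Real.norm_eq_abs, abs_of_nonpos]
    · ring
    · have : 1 < r⁻¹ := (one_lt_inv₀ hr).2 hr1
      linarith
  have hBA2 : ‖B + A‖ ≤ (1 + r⁻¹) * ‖A‖ := by
    refine (norm_add_le _ _).trans ?_
    rw [key]; linarith
  rw [e, norm_div, norm_mul, norm_mul, norm_pow, norm_pow, hBA, key]
  have h1 : 0 ≤ r⁻¹ - r := by rw [← hBA]; positivity
  calc (r⁻¹ - r) * ‖B + A‖ / (‖A‖^2 * (r⁻¹ * ‖A‖)^2) ≤ (r⁻¹ - r) * ((1 + r⁻¹) * ‖A‖) / (‖A‖^2 * (r⁻¹ * ‖A‖)^2) := by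
        gcongr
    _ = (1 - r^2) * (1 + r) / ‖A‖^3 := by field_simp; ring
    _ ≤ (1 - r^2) * 2 / ‖A‖^3 := by
        have : 0 ≤ 1 - r^2 := by nlinarith
        gcongr; linarith
    _ = _ := by ring

lemma aux_radial0 (H : ℂ → ℂ) (hc : Continuous H) (hd : DifferentiableOn ℂ H (ball (0:ℂ) 1))
    (ζ0 : ℂ) (h0 : ‖ζ0‖ = 1)
    (ho : ∀ ε > 0, ∃ δ > 0, ∀ ζ : ℂ, ‖ζ‖ = 1 → ‖ζ - ζ0‖ < δ → ‖H ζ‖ ≤ ε * ‖ζ - ζ0‖) :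
    Tendsto (fun r : ℝ => deriv H (r * ζ0)) (𝓝[<] (1:ℝ)) (𝓝 0) := by
  obtain ⟨M, hM⟩ : ∃ M, ∀ ζ ∈ sphere (0:ℂ) 1, ‖H ζ‖ ≤ M :=
    (isCompact_sphere (0:ℂ) 1).exists_bound_of_continuousOn hc.continuousOn
  have hM0 : 0 ≤ M := (norm_nonneg _).trans (hM 1 (by simp))
  have main : ∀ ε > 0, ∀ δ > 0, (∀ ζ : ℂ, ‖ζ‖ = 1 → ‖ζ - ζ0‖ < δ → ‖H ζ‖ ≤ ε * ‖ζ - ζ0‖) →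
      ∀ r : ℝ, 0 < r → r < 1 → ‖deriv H (r * ζ0)‖ ≤ 4 * ε + 16 * M / δ^3 * (1 - r^2) := by
    intro ε hε δ hδ h r hr hr1
    have hr2 : 0 ≤ 1 - r^2 := by nlinarith
    have hnz : ‖(r:ℂ) * ζ0‖ = r := by simp [h0, abs_of_pos hr]
    have hz : (r:ℂ) * ζ0 ∈ ball (0:ℂ) 1 := by simpa [h0, abs_of_pos hr] using hr1
    have hz' : 1 < ‖((r⁻¹:ℝ):ℂ) * ζ0‖ := by
      simp only [norm_mul, h0, Complex.norm_real, mul_one, Real.norm_eq_abs]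
      rw [abs_of_pos (by positivity)]
      exact (one_lt_inv₀ hr).2 hr1
    have e1 := aux_deriv_repr H hc hd _ hz
    have e2 := aux_zero_repr H hc hd _ hz'
    have hge : ∀ ζ : ℂ, ‖ζ‖ = 1 → 1 - r ≤ ‖ζ - r * ζ0‖ := by
      intro ζ hζ
      have := norm_sub_norm_le ζ (r * ζ0)
      rwa [hζ, hnz] at this
    have hcm : ∀ θ, ‖circleMap 0 1 θ‖ = 1 := by intro θ; simp
    have hcont : ∀ a : ℂ, ‖a‖ ≠ 1 → ContinuousOn (fun ζ : ℂ => ((ζ - a)^2)⁻¹ * H ζ) (sphere (0:ℂ) 1) := by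
      intro a ha
      refine ContinuousOn.mul (ContinuousOn.inv₀ (by fun_prop) ?_) hc.continuousOn
      intro x hx hh
      rw [pow_eq_zero_iff two_ne_zero, sub_eq_zero] at hh
      subst hh
      simp at hx
      exact ha hx
    have e3 : ∮ ζ in C(0, 1), ((((ζ - r * ζ0)^2)⁻¹ * H ζ) - (((ζ - (r⁻¹:ℝ) * ζ0)^2)⁻¹ * H ζ)) =
        (2 * Real.pi * I) * deriv H (r * ζ0) := by
      rw [circleIntegral.integral_sub, e1, e2, sub_zero]
      · exact (hcont _ (by rw [hnz]; exact hr1.ne)).circleIntegrable zero_le_one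
      · exact (hcont _ hz'.ne').circleIntegrable zero_le_one
    have hcP : Continuous (fun θ : ℝ => (1 - r^2) / ‖circleMap 0 1 θ - r * ζ0‖^2) := by
      apply Continuous.div continuous_const (by fun_prop)
      intro θ
      have := hge _ (hcm θ)
      have : 0 < ‖circleMap 0 1 θ - r * ζ0‖ := by linarith
      positivity
    have hbd : ∀ ζ : ℂ, ‖ζ‖ = 1 → ‖(((ζ - r * ζ0)^2)⁻¹ * H ζ) - (((ζ - (r⁻¹:ℝ) * ζ0)^2)⁻¹ * H ζ)‖ ≤
        4 * ε * ((1 - r^2) / ‖ζ - r * ζ0‖^2) + 16 * M / δ^3 * (1 - r^2) := by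
      intro ζ hζ
      rw [← sub_mul, norm_mul]
      have hk := aux_kernel ζ ζ0 r hr hr1 hζ h0
      have hA := hge ζ hζ
      have hA0 : 0 < ‖ζ - r * ζ0‖ := by linarith
      have hle : ‖ζ - ζ0‖ ≤ 2 * ‖ζ - r * ζ0‖ := by
        have h1 : ζ - ζ0 = (ζ - r * ζ0) + ((r - 1 : ℝ) : ℂ) * ζ0 := by push_cast; ring
        have h2 : ‖((r - 1 : ℝ) : ℂ) * ζ0‖ = 1 - r := by
          rw [norm_mul, h0, Complex.norm_real, Real.norm_eq_abs, abs_of_nonpos (by linarith)]; ring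
        rw [h1]
        refine (norm_add_le _ _).trans ?_
        rw [h2]; linarith
      by_cases hd : ‖ζ - ζ0‖ < δ
      · have hH := h ζ hζ hd
        calc _ ≤ 2 * (1 - r^2) / ‖ζ - r * ζ0‖^3 * (ε * (2 * ‖ζ - r * ζ0‖)) := by
              gcongr
              exact hH.trans (by gcongr)
          _ = 4 * ε * ((1 - r^2) / ‖ζ - r * ζ0‖^2) := by field_simp; ring
          _ ≤ _ := by
              have : 0 ≤ 16 * M / δ^3 * (1 - r^2) := by positivity
              linarith
      · have hd2 : δ / 2 ≤ ‖ζ - r * ζ0‖ := by linarith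
        calc _ ≤ 2 * (1 - r^2) / (δ/2)^3 * M := by
              gcongr
              · exact hk.trans (by gcongr)
              · exact hM ζ (by simpa using hζ)
          _ = 16 * M / δ^3 * (1 - r^2) := by field_simp; ring
          _ ≤ _ := by
              have : 0 ≤ 4 * ε * ((1 - r^2) / ‖ζ - r * ζ0‖^2) := by positivity
              linarith
    have e4 : ‖∮ ζ in C(0, 1), ((((ζ - r * ζ0)^2)⁻¹ * H ζ) - (((ζ - (r⁻¹:ℝ) * ζ0)^2)⁻¹ * H ζ))‖ ≤
        ∫ θ in (0:ℝ)..(2*Real.pi), (4 * ε * ((1 - r^2) / ‖circleMap 0 1 θ - r * ζ0‖^2) + 16 * M / δ^3 * (1 - r^2)) := by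
      rw [circleIntegral]
      apply intervalIntegral.norm_integral_le_of_norm_le Real.two_pi_pos.le
      · refine Eventually.of_forall fun θ _ => ?_
        rw [norm_smul]
        have : ‖deriv (circleMap 0 1) θ‖ = 1 := by simp
        rw [this, one_mul]
        exact hbd _ (hcm θ)
      · exact (Continuous.intervalIntegrable (by fun_prop) _ _)
    have e5 := aux_poisson _ hz
    rw [hnz] at e5
    rw [e3, intervalIntegral.integral_add, intervalIntegral.integral_const_mul, e5,
      intervalIntegral.integral_const] at e4
    · simp [abs_of_pos Real.pi_pos] at e4
      have hp := Real.two_pi_pos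
      have : (2 * Real.pi) * ‖deriv H (r * ζ0)‖ ≤ (2 * Real.pi) * (4 * ε + 16 * M / δ^3 * (1 - r^2)) := by linarith
      exact le_of_mul_le_mul_left this hp
    · exact (hcP.const_mul _ |>.intervalIntegrable _ _)
    · exact intervalIntegrable_const
  rw [Metric.tendsto_nhds]
  intro ε hε
  obtain ⟨δ, hδ, h⟩ := ho (ε/8) (by positivity)
  have ht : Tendsto (fun r : ℝ => 4 * (ε/8) + 16 * M / δ^3 * (1 - r^2)) (𝓝[<] (1:ℝ)) (𝓝 (ε/2)) := by
    have : Continuous (fun r : ℝ => 4 * (ε/8) + 16 * M / δ^3 * (1 - r^2)) := by fun_prop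
    have h1 := this.tendsto 1
    have e : 4 * (ε/8) + 16 * M / δ^3 * (1 - (1:ℝ)^2) = ε/2 := by ring
    simp only [e] at h1
    exact h1.mono_left nhdsWithin_le_nhds
  filter_upwards [ht.eventually (gt_mem_nhds (by linarith : ε/2 < ε)), self_mem_nhdsWithin,
    nhdsWithin_le_nhds (lt_mem_nhds (zero_lt_one))] with r h1 h2 h3
  rw [dist_zero_right]
  exact (main _ (by positivity) δ hδ h r h3 h2).trans_lt h1

lemma aux_fatou (φ : ℂ → ℂ) (hφ : DifferentiableOn ℂ φ (ball (0:ℂ) 1))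
    (hb : ∀ z ∈ ball (0:ℂ) 1, ‖φ z‖ ≤ 1) :
    ∀ᵐ θ : ℝ, ∃ l : ℂ, Tendsto (fun r : ℝ => φ ((r : ℂ) * Complex.exp (θ * Complex.I)))
        (𝓝[<] (1:ℝ)) (𝓝 l) := by
  obtain ⟨F, hF⟩ := hφ.isExactOn_ball
  have hL : LipschitzOnWith 1 F (ball (0:ℂ) 1) := by
    apply (convex_ball (0:ℂ) 1).lipschitzOnWith_of_nnnorm_hasDerivWithin_le
      (fun x hx => (hF x hx).hasDerivWithinAt)
    intro x hx
    exact_mod_cast hb x hx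
  obtain ⟨g, hgL, hg⟩ := hL.extend_finite_dimension
  have hgd : ∀ z ∈ ball (0:ℂ) 1, HasDerivAt g (φ z) z := by
    intro z hz
    refine (hF z hz).congr_of_eventuallyEq ?_
    filter_upwards [isOpen_ball.mem_nhds hz] with x hx using (hg hx).symm
  have hLc : LipschitzWith _ (fun θ : ℝ => g (circleMap 0 1 θ)) := hgL.comp (lipschitzWith_circleMap 0 1)
  filter_upwards [hLc.ae_differentiableAt_real] with θ hθ
  set ζ0 : ℂ := Complex.exp (θ * I) with hζ0
  have hcm : ∀ t : ℝ, circleMap 0 1 t = Complex.exp (t * I) := by intro t; simp [circleMap]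
  have h0 : ‖ζ0‖ = 1 := by rw [hζ0, ← hcm]; simp
  have h00 : ζ0 ≠ 0 := by intro h; simp [h] at h0
  set D := deriv (fun θ : ℝ => g (circleMap 0 1 θ)) θ with hD
  set c := D / (ζ0 * I) with hcdef
  have hcD : c * (ζ0 * I) = D := by rw [hcdef]; field_simp
  refine ⟨c, ?_⟩
  set H : ℂ → ℂ := fun z => g z - g ζ0 - c * (z - ζ0) with hH
  have hHc : Continuous H := by
    have := hgL.continuous
    fun_prop
  have hHd : ∀ z ∈ ball (0:ℂ) 1, HasDerivAt H (φ z - c) z := by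
    intro z hz
    have := ((hgd z hz).sub_const (g ζ0)).sub (((hasDerivAt_id z).sub_const ζ0).const_mul c)
    simpa using! this
  -- the real derivative along the circle
  have hder : HasDerivAt (fun t : ℝ => H (circleMap 0 1 t)) 0 θ := by
    have h1 := ((hθ.hasDerivAt).sub_const (g ζ0)).sub (((hasDerivAt_circleMap 0 1 θ).sub_const ζ0).const_mul c)
    refine h1.congr_deriv ?_
    rw [hcm, ← hζ0, hcD, hD]; simp
  have ho : ∀ ε > 0, ∃ δ > 0, ∀ ζ : ℂ, ‖ζ‖ = 1 → ‖ζ - ζ0‖ < δ → ‖H ζ‖ ≤ ε * ‖ζ - ζ0‖ := by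
    intro ε hε
    have hpi := Real.pi_pos
    have hHz : H (circleMap 0 1 θ) = 0 := by simp [hH, hcm, ← hζ0]
    have h1 := (hasDerivAt_iff_isLittleO.1 hder).def (c := ε / (Real.pi / 2)) (by positivity)
    simp only [hHz, sub_zero, smul_zero] at h1
    obtain ⟨δ, hδ, h2⟩ := Metric.eventually_nhds_iff.1 h1
    refine ⟨δ / (Real.pi / 2), by positivity, ?_⟩
    intro ζ hζ hζd
    have h3 := Complex.angle_le_mul_norm_sub hζ h0
    have hζn : ζ ≠ 0 := by intro h; simp [h] at hζ
    rw [Complex.angle_eq_abs_arg hζn h00] at h3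
    rw [lt_div_iff₀ (by positivity)] at hζd
    have h4 : |(ζ / ζ0).arg| < δ := by linarith
    have h5 : circleMap 0 1 (θ + (ζ / ζ0).arg) = ζ := by
      rw [hcm]
      push_cast
      rw [add_mul, Complex.exp_add, ← hζ0]
      have h6 := Complex.norm_mul_exp_arg_mul_I (ζ / ζ0)
      rw [norm_div, hζ, h0] at h6
      simp only [div_one, ofReal_one, one_mul] at h6
      rw [h6]; field_simp
    have h7 := @h2 (θ + (ζ / ζ0).arg) (by rw [Real.dist_eq]; simpa using h4)
    rw [h5] at h7
    refine h7.trans ?_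
    rw [Real.norm_eq_abs, add_sub_cancel_left]
    calc ε / (Real.pi/2) * |(ζ / ζ0).arg| ≤ ε / (Real.pi/2) * (Real.pi/2 * ‖ζ - ζ0‖) := by gcongr
      _ = _ := by field_simp
  have h1 := aux_radial0 H hHc (fun z hz => (hHd z hz).differentiableAt.differentiableWithinAt) ζ0 h0 ho
  have h2 : Tendsto (fun r : ℝ => deriv H (r * ζ0) + c) (𝓝[<] (1:ℝ)) (𝓝 c) := by
    simpa using h1.add_const c
  refine h2.congr' ?_
  filter_upwards [self_mem_nhdsWithin,
    nhdsWithin_le_nhds (lt_mem_nhds (zero_lt_one))] with r h2 h3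
  have hz : (r:ℂ) * ζ0 ∈ ball (0:ℂ) 1 := by simpa [h0, abs_of_pos h3] using h2
  rw [(hHd _ hz).deriv]; ring

/-- radii tending to one -/
noncomputable def rr (k : ℕ) : ℝ := 1 - 1 / ((k:ℝ) + 2)

lemma rr_lt (k : ℕ) : rr k < 1 := by
  have : 0 < 1 / ((k:ℝ) + 2) := by positivity
  simp only [rr]; linarith

lemma rr_half (k : ℕ) : 1 / 2 ≤ rr k := by
  have : 1 / ((k:ℝ) + 2) ≤ 1 / 2 := by
    apply one_div_le_one_div_of_le <;> [norm_num; linarith [(Nat.cast_nonneg k : (0:ℝ) ≤ k)]]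
  simp only [rr]; linarith

lemma rr_pos (k : ℕ) : 0 < rr k := by linarith [rr_half k]

lemma rr_tendsto : Tendsto rr atTop (𝓝 1) := by
  have h1 : Tendsto (fun k : ℕ => 1 / ((k:ℝ) + 2)) atTop (𝓝 0) := by
    have := (tendsto_one_div_add_atTop_nhds_zero_nat (𝕜 := ℝ)).comp (tendsto_add_atTop_nat 1)
    refine this.congr fun k => ?_
    simp; ring
  have h2 := h1.const_sub 1
  rw [sub_zero] at h2
  exact h2

lemma rr_tendsto' : Tendsto rr atTop (𝓝[<] 1) :=
  tendsto_nhdsWithin_iff.2 ⟨rr_tendsto, Eventually.of_forall rr_lt⟩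

lemma cm_ball (k : ℕ) (θ : ℝ) : circleMap 0 (rr k) θ ∈ ball (0:ℂ) 1 := by
  simp [abs_of_pos (rr_pos k), rr_lt k]

lemma cm_norm (k : ℕ) (θ : ℝ) : ‖circleMap 0 (rr k) θ‖ = rr k := by
  simp [abs_of_pos (rr_pos k)]

lemma ev_summable (f : H2) (z : ℂ) (hz : ‖z‖ < 1) : Summable (fun n => ‖f n * z ^ n‖) := by
  refine Summable.of_nonneg_of_le (fun _ => norm_nonneg _) (fun n => ?_)
    ((summable_geometric_of_lt_one (norm_nonneg z) hz).mul_left ‖f‖)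
  rw [norm_mul, norm_pow]
  gcongr
  exact lp.norm_apply_le_norm (by norm_num) f n

lemma ev_hasSum (f : H2) (z : ℂ) (hz : ‖z‖ < 1) : HasSum (fun n => f n * z ^ n) (H2.eval f z) :=
  (ev_summable f z hz).of_norm.hasSum

lemma ev_sub (f g : H2) (z : ℂ) (hz : ‖z‖ < 1) : H2.eval (f - g) z = H2.eval f z - H2.eval g z := by
  have := (ev_hasSum f z hz).sub (ev_hasSum g z hz)
  refine (ev_hasSum (f - g) z hz).unique (this.congr_fun ?_)
  intro n
  simp [sub_mul]

lemma ev_single (n : ℕ) (a z : ℂ) : H2.eval (lp.single 2 n a) z = a * z ^ n := by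
  unfold H2.eval
  rw [tsum_eq_single n]
  · simp
  · intro m hm
    simp [hm]

lemma ev_cont (f : H2) (k : ℕ) : Continuous (fun θ : ℝ => H2.eval f (circleMap 0 (rr k) θ)) := by
  unfold H2.eval
  refine continuous_tsum (u := fun n => ‖f n * ((rr k : ℝ):ℂ)^n‖) (fun n => by fun_prop)
    (ev_summable f _ (by rw [Complex.norm_real, Real.norm_eq_abs, abs_of_pos (rr_pos k)]; exact rr_lt k)) ?_
  intro n θ
  simp [abs_of_pos (rr_pos k)]

lemma ev_step (f : H2) (k : ℕ) (h : ℝ → ℂ) (hh : Continuous h) :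
    HasSum (fun n => f n * ∫ θ in (0:ℝ)..(2*Real.pi), (circleMap 0 (rr k) θ)^n * h θ)
      (∫ θ in (0:ℝ)..(2*Real.pi), H2.eval f (circleMap 0 (rr k) θ) * h θ) := by
  have := intervalIntegral.hasSum_integral_of_dominated_convergence (μ := volume) (a := 0) (b := 2 * Real.pi)
    (F := fun n θ => f n * (circleMap 0 (rr k) θ)^n * h θ)
    (f := fun θ => H2.eval f (circleMap 0 (rr k) θ) * h θ)
    (fun n θ => ‖f n * ((rr k : ℝ):ℂ)^n‖ * ‖h θ‖) ?_ ?_ ?_ ?_ ?_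
  · refine this.congr_fun ?_
    intro n
    rw [← intervalIntegral.integral_const_mul]
    congr 1; ext θ; ring
  · intro n
    exact (Continuous.aestronglyMeasurable (by fun_prop))
  · intro n
    refine Eventually.of_forall fun θ _ => ?_
    simp [abs_of_pos (rr_pos k)]
  · refine Eventually.of_forall fun θ _ => ?_
    exact (ev_summable f _ (by rw [Complex.norm_real, Real.norm_eq_abs, abs_of_pos (rr_pos k)]; exact rr_lt k)).mul_right _
  · simp_rw [tsum_mul_right]
    exact Continuous.intervalIntegrable (by fun_prop) _ _
  · refine Eventually.of_forall fun θ _ => ?_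
    exact (ev_hasSum f _ (by rw [cm_norm]; exact rr_lt k)).mul_right _

lemma cm_orth (k n m : ℕ) :
    ∫ θ in (0:ℝ)..(2*Real.pi), (circleMap 0 (rr k) θ)^n * (starRingEnd ℂ) ((circleMap 0 (rr k) θ)^m)
      = if n = m then 2 * Real.pi * ((rr k : ℝ):ℂ)^(2*n) else 0 := by
  have e : ∀ θ : ℝ, (circleMap 0 (rr k) θ)^n * (starRingEnd ℂ) ((circleMap 0 (rr k) θ)^m)
      = ((rr k : ℝ):ℂ)^(n+m) * Complex.exp ((((n:ℂ) - m) * I) * θ) := by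
    intro θ
    simp only [circleMap, zero_add, mul_pow, map_mul, map_pow, Complex.conj_ofReal, ← Complex.exp_conj,
      ← Complex.exp_nat_mul, Complex.conj_I]
    rw [mul_mul_mul_comm, ← pow_add, ← Complex.exp_add]
    congr 2
    simp only [map_natCast]
    ring
  simp_rw [e]
  rw [intervalIntegral.integral_const_mul]
  split_ifs with h
  · subst h
    simp [two_mul]
    ring
  · have hne : ((n:ℂ) - m) * I ≠ 0 := by
      apply mul_ne_zero _ I_ne_zero
      rw [sub_ne_zero]; exact_mod_cast h
    rw [integral_exp_mul_complex hne]
    have : Complex.exp ((((n:ℂ) - m) * I) * ((2 * Real.pi : ℝ):ℂ)) = 1 := by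
      rw [Complex.exp_eq_one_iff]
      refine ⟨(n:ℤ) - m, ?_⟩
      push_cast; ring
    rw [this]; simp

lemma ev_parseval (f g : H2) (k : ℕ) :
    HasSum (fun n => 2 * Real.pi * (inner ℂ (f n) (g n) * ((rr k : ℝ):ℂ)^(2*n)))
      (∫ θ in (0:ℝ)..(2*Real.pi), H2.eval g (circleMap 0 (rr k) θ) *
        (starRingEnd ℂ) (H2.eval f (circleMap 0 (rr k) θ))) := by
  have hcf := ev_cont f k
  refine (ev_step g k (fun θ => (starRingEnd ℂ) (H2.eval f (circleMap 0 (rr k) θ)))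
    (Complex.continuous_conj.comp hcf)).congr_fun ?_
  intro n
  have h1 := ev_step f k (fun θ => (starRingEnd ℂ) ((circleMap 0 (rr k) θ)^n))
    (Complex.continuous_conj.comp (by fun_prop))
  simp_rw [cm_orth] at h1
  have h2 := h1.unique (hasSum_single n (by intro m hm; simp [hm]))
  have h3 : ∫ θ in (0:ℝ)..(2*Real.pi), (circleMap 0 (rr k) θ)^n * (starRingEnd ℂ) (H2.eval f (circleMap 0 (rr k) θ))
    = (starRingEnd ℂ) (∫ θ in (0:ℝ)..(2*Real.pi), H2.eval f (circleMap 0 (rr k) θ) * (starRingEnd ℂ) ((circleMap 0 (rr k) θ)^n)) := by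
    rw [intervalIntegral.integral_of_le Real.two_pi_pos.le, intervalIntegral.integral_of_le Real.two_pi_pos.le,
      ← integral_conj]
    congr 1; ext θ
    simp [mul_comm]
  rw [h3, h2]
  have h4 : (starRingEnd ℂ) (2:ℂ) = 2 := map_ofNat _ 2
  simp [h4]
  ring

lemma ev_tendsto (f g : H2) :
    Tendsto (fun k => ∫ θ in (0:ℝ)..(2*Real.pi), H2.eval g (circleMap 0 (rr k) θ) *
        (starRingEnd ℂ) (H2.eval f (circleMap 0 (rr k) θ))) atTop (𝓝 (2 * Real.pi * inner ℂ f g)) := by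
  simp_rw [← (ev_parseval f g _).tsum_eq]
  simp_rw [tsum_mul_left]
  refine Tendsto.const_mul _ ?_
  rw [lp.inner_eq_tsum]
  have hs : Summable (fun n => inner ℂ (f n) (g n)) := lp.summable_inner (𝕜 := ℂ) f g
  have hs' : Summable (fun n => ‖inner ℂ (f n) (g n)‖) := hs.norm
  refine tendsto_tsum_of_dominated_convergence hs' ?_ ?_
  · intro n
    have hc : Continuous (fun r : ℝ => inner ℂ (f n) (g n) * (r:ℂ)^(2*n)) := by fun_prop
    have h2 := (hc.tendsto 1).comp rr_tendsto
    rw [Complex.ofReal_one, one_pow, mul_one] at h2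
    exact h2
  · refine Eventually.of_forall fun k n => ?_
    rw [norm_mul, norm_pow, Complex.norm_real, Real.norm_eq_abs, abs_of_pos (rr_pos k)]
    exact mul_le_of_le_one_right (norm_nonneg _) (pow_le_one₀ (rr_pos k).le (rr_lt k).le)

lemma ev_sq_eq (f : H2) (k : ℕ) : ((∫ θ in (0:ℝ)..(2*Real.pi), ‖H2.eval f (circleMap 0 (rr k) θ)‖^2 : ℝ) : ℂ)
    = ∫ θ in (0:ℝ)..(2*Real.pi), H2.eval f (circleMap 0 (rr k) θ) *
        (starRingEnd ℂ) (H2.eval f (circleMap 0 (rr k) θ)) := by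
  rw [← intervalIntegral.integral_ofReal]
  congr 1; ext θ
  rw [Complex.mul_conj, Complex.normSq_eq_norm_sq]

lemma ev_sq_tendsto (f : H2) : Tendsto (fun k => ∫ θ in (0:ℝ)..(2*Real.pi), ‖H2.eval f (circleMap 0 (rr k) θ)‖^2)
    atTop (𝓝 (2 * Real.pi * ‖f‖^2)) := by
  have h := ev_tendsto f f
  simp_rw [← ev_sq_eq] at h
  rw [inner_self_eq_norm_sq_to_K] at h
  have e : (2 * Real.pi * ((‖f‖ : ℝ):ℂ)^2) = ((2 * Real.pi * ‖f‖^2 : ℝ) : ℂ) := by push_cast; rfl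
  have h2 := (Complex.continuous_re.tendsto _).comp (h.trans (le_of_eq (congrArg 𝓝 e)))
  exact h2

lemma ev_sq_le (f : H2) (k : ℕ) : ∫ θ in (0:ℝ)..(2*Real.pi), ‖H2.eval f (circleMap 0 (rr k) θ)‖^2
    ≤ 2 * Real.pi * ‖f‖^2 := by
  have h := ev_parseval f f k
  rw [← ev_sq_eq] at h
  have h1 : HasSum (fun n => 2 * Real.pi * (‖f n‖^2 * (rr k)^(2*n))) (∫ θ in (0:ℝ)..(2*Real.pi), ‖H2.eval f (circleMap 0 (rr k) θ)‖^2) := by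
    rw [← Complex.hasSum_ofReal]
    refine h.congr_fun fun n => ?_
    rw [inner_self_eq_norm_sq_to_K]
    push_cast
    rfl
  have h2 := (lp.hasSum_norm (p := 2) (by norm_num) f).mul_left (2 * Real.pi)
  simp only [ENNReal.toReal_ofNat, Real.rpow_ofNat] at h2
  refine hasSum_le (fun n => ?_) h1 h2
  have := Real.pi_pos
  gcongr
  exact mul_le_of_le_one_right (by positivity) (pow_le_one₀ (rr_pos k).le (rr_lt k).le)

lemma ev_inj (f g : H2) (h : ∀ z ∈ ball (0:ℂ) 1, H2.eval f z = H2.eval g z) : f = g := by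
  rw [← sub_eq_zero, ← norm_eq_zero]
  have h1 := ev_sq_tendsto (f - g)
  have h2 : ∀ k, ∫ θ in (0:ℝ)..(2*Real.pi), ‖H2.eval (f - g) (circleMap 0 (rr k) θ)‖^2 = 0 := by
    intro k
    have : ∀ θ, H2.eval (f - g) (circleMap 0 (rr k) θ) = 0 := by
      intro θ
      rw [ev_sub _ _ _ (by rw [cm_norm]; exact rr_lt k), h _ (cm_ball k θ), sub_self]
    simp [this]
  simp_rw [h2] at h1
  have := tendsto_nhds_unique h1 tendsto_const_nhds
  have hp := Real.pi_pos.ne'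
  simpa [hp] using this

lemma cont_cm (φ : ℂ → ℂ) (hφ : DifferentiableOn ℂ φ (ball (0:ℂ) 1)) (k : ℕ) :
    Continuous (fun θ : ℝ => φ (circleMap 0 (rr k) θ)) :=
  hφ.continuousOn.comp_continuous (by fun_prop) (cm_ball k)

lemma cont_def (φ : ℂ → ℂ) (hφ : DifferentiableOn ℂ φ (ball (0:ℂ) 1)) (k m : ℕ) :
    Continuous (fun θ : ℝ => 1 - ‖φ (circleMap 0 (rr k) θ)‖^(2*m)) :=
  continuous_const.sub ((cont_cm φ hφ k).norm.pow _)

lemma B_defect (φ : ℂ → ℂ) (hφ : DifferentiableOn ℂ φ (ball (0:ℂ) 1))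
    (hb : ∀ z ∈ ball (0:ℂ) 1, ‖φ z‖ ≤ 1)
    (hl : ∀ᵐ θ : ℝ, ∃ l : ℂ, ‖l‖ = 1 ∧
      Tendsto (fun r : ℝ => φ ((r : ℂ) * Complex.exp (θ * Complex.I)))
        (𝓝[<] (1:ℝ)) (𝓝 l)) (W : H2) (m : ℕ) :
    Tendsto (fun k => ∫ θ in (0:ℝ)..(2*Real.pi), ‖H2.eval W (circleMap 0 (rr k) θ)‖^2 *
      (1 - ‖φ (circleMap 0 (rr k) θ)‖^(2*m))) atTop (𝓝 0) := by
  have hpi := Real.pi_pos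
  have hcφ := cont_cm φ hφ
  have hbk : ∀ k θ, 0 ≤ 1 - ‖φ (circleMap 0 (rr k) θ)‖^(2*m) ∧
      1 - ‖φ (circleMap 0 (rr k) θ)‖^(2*m) ≤ 1 := by
    intro k θ
    have h1 := pow_le_one₀ (n := 2*m) (norm_nonneg _) (hb _ (cm_ball k θ))
    have h2 : 0 ≤ ‖φ (circleMap 0 (rr k) θ)‖^(2*m) := by positivity
    constructor <;> linarith
  have hD : Tendsto (fun k => ∫ θ in (0:ℝ)..(2*Real.pi),
      (1 - ‖φ (circleMap 0 (rr k) θ)‖^(2*m))) atTop (𝓝 0) := by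
    have := intervalIntegral.tendsto_integral_filter_of_dominated_convergence (μ := volume)
      (a := 0) (b := 2 * Real.pi) (l := atTop)
      (F := fun k θ => (1 - ‖φ (circleMap 0 (rr k) θ)‖^(2*m))) (f := fun _ => (0:ℝ)) (fun _ => (1:ℝ))
      ?_ ?_ ?_ ?_
    · simpa using this
    · refine Eventually.of_forall fun k => ?_
      exact (cont_def φ hφ k m).aestronglyMeasurable
    · refine Eventually.of_forall fun k => Eventually.of_forall fun θ _ => ?_
      rw [Real.norm_eq_abs, abs_of_nonneg (hbk k θ).1]
      exact (hbk k θ).2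
    · exact intervalIntegrable_const
    · filter_upwards [hl] with θ hθ _
      obtain ⟨l, hl1, hl2⟩ := hθ
      have h1 := ((hl2.comp rr_tendsto').norm.pow (2*m)).const_sub 1
      rw [hl1] at h1
      simpa [circleMap_zero] using h1
  rw [Metric.tendsto_nhds]
  intro ε hε
  -- polynomial approximation
  have hsum := lp.hasSum_single (p := 2) (by norm_num) W
  obtain ⟨s, hs⟩ := (Metric.tendsto_nhds.1 hsum (Real.sqrt (ε / (16 * Real.pi))) (by positivity)).exists
  set P : H2 := ∑ i ∈ s, lp.single 2 i (W i) with hP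
  rw [dist_comm, dist_eq_norm] at hs
  have hs2 : ‖W - P‖^2 ≤ ε / (16 * Real.pi) := by
    have := pow_le_pow_left₀ (norm_nonneg _) hs.le 2
    rwa [Real.sq_sqrt (by positivity)] at this
  obtain ⟨C, hC0, hC⟩ : ∃ C, 0 ≤ C ∧ ∀ k θ, ‖H2.eval P (circleMap 0 (rr k) θ)‖ ≤ C := by
    refine ⟨∑ i ∈ s, ‖W i‖, by positivity, fun k θ => ?_⟩
    have e : ∀ i, P i = if i ∈ s then W i else 0 := by
      intro i
      rw [hP, lp.coeFn_sum]
      simp [Finset.sum_apply, Pi.single_apply]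
    unfold H2.eval
    rw [tsum_eq_sum (s := s) (by intro b hb; simp [e, hb])]
    refine norm_sum_le_of_le _ fun i hi => ?_
    rw [e, if_pos hi, norm_mul, norm_pow, cm_norm]
    exact mul_le_of_le_one_right (norm_nonneg _) (pow_le_one₀ (rr_pos k).le (rr_lt k).le)
  have hD2 : Tendsto (fun k => 2 * C^2 * ∫ θ in (0:ℝ)..(2*Real.pi),
      (1 - ‖φ (circleMap 0 (rr k) θ)‖^(2*m))) atTop (𝓝 0) := by simpa using hD.const_mul (2 * C^2)
  filter_upwards [hD2.eventually (gt_mem_nhds (by linarith : 0 < ε/2))] with k hk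
  have hcW := ev_cont W k
  have hcQ := ev_cont (W - P) k
  have hck := cont_def φ hφ k m
  have hnn : 0 ≤ ∫ θ in (0:ℝ)..(2*Real.pi), ‖H2.eval W (circleMap 0 (rr k) θ)‖^2 *
      (1 - ‖φ (circleMap 0 (rr k) θ)‖^(2*m)) := by
    apply intervalIntegral.integral_nonneg Real.two_pi_pos.le
    intro θ _
    exact mul_nonneg (by positivity) (hbk k θ).1
  rw [Real.dist_eq, sub_zero, abs_of_nonneg hnn]
  have hle : ∫ θ in (0:ℝ)..(2*Real.pi), ‖H2.eval W (circleMap 0 (rr k) θ)‖^2 *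
      (1 - ‖φ (circleMap 0 (rr k) θ)‖^(2*m)) ≤ ∫ θ in (0:ℝ)..(2*Real.pi),
      (2 * ‖H2.eval (W - P) (circleMap 0 (rr k) θ)‖^2 + 2 * C^2 * (1 - ‖φ (circleMap 0 (rr k) θ)‖^(2*m))) := by
    apply intervalIntegral.integral_mono_on Real.two_pi_pos.le
    · exact ((hcW.norm.pow 2).mul hck).intervalIntegrable _ _
    · exact (((hcQ.norm.pow 2).const_mul 2).add (hck.const_mul _)).intervalIntegrable _ _
    · intro θ _
      have h1 : ‖H2.eval W (circleMap 0 (rr k) θ)‖ ≤ ‖H2.eval (W - P) (circleMap 0 (rr k) θ)‖ + C := by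
        have e : H2.eval W (circleMap 0 (rr k) θ) = H2.eval (W - P) (circleMap 0 (rr k) θ) + H2.eval P (circleMap 0 (rr k) θ) := by
          rw [ev_sub _ _ _ (by rw [cm_norm]; exact rr_lt k)]; ring
        rw [e]
        exact (norm_add_le _ _).trans (by linarith [hC k θ])
      have h2 : ‖H2.eval W (circleMap 0 (rr k) θ)‖^2 ≤ 2 * ‖H2.eval (W - P) (circleMap 0 (rr k) θ)‖^2 + 2 * C^2 := by
        have := pow_le_pow_left₀ (norm_nonneg _) h1 2
        nlinarith [sq_nonneg (‖H2.eval (W - P) (circleMap 0 (rr k) θ)‖ - C)]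
      have h3 := hbk k θ
      calc _ ≤ (2 * ‖H2.eval (W - P) (circleMap 0 (rr k) θ)‖^2 + 2 * C^2) * (1 - ‖φ (circleMap 0 (rr k) θ)‖^(2*m)) := by
            gcongr; exact h3.1
        _ ≤ _ := by
            rw [add_mul]
            have := mul_le_of_le_one_right (a := 2 * ‖H2.eval (W - P) (circleMap 0 (rr k) θ)‖^2) (by positivity) h3.2
            linarith
  have i1 : IntervalIntegrable (fun θ => 2 * ‖H2.eval (W - P) (circleMap 0 (rr k) θ)‖^2) volume 0 (2*Real.pi) :=
    ((hcQ.norm.pow 2).const_mul 2).intervalIntegrable _ _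
  have i2 : IntervalIntegrable (fun θ => 2 * C^2 * (1 - ‖φ (circleMap 0 (rr k) θ)‖^(2*m))) volume 0 (2*Real.pi) :=
    (hck.const_mul _).intervalIntegrable _ _
  rw [intervalIntegral.integral_add i1 i2, intervalIntegral.integral_const_mul,
    intervalIntegral.integral_const_mul] at hle
  have h4 := ev_sq_le (W - P) k
  have h5 : 2 * Real.pi * ‖W - P‖^2 ≤ 2 * Real.pi * (ε / (16 * Real.pi)) := by gcongr
  have h6 : 2 * Real.pi * (ε / (16 * Real.pi)) = ε / 8 := by field_simp; ring
  linarith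

lemma B_inner (φ w : ℂ → ℂ) (hφ : DifferentiableOn ℂ φ (ball (0:ℂ) 1))
    (hb : ∀ z ∈ ball (0:ℂ) 1, ‖φ z‖ ≤ 1)
    (hl : ∀ᵐ θ : ℝ, ∃ l : ℂ, ‖l‖ = 1 ∧
      Tendsto (fun r : ℝ => φ ((r : ℂ) * Complex.exp (θ * Complex.I)))
        (𝓝[<] (1:ℝ)) (𝓝 l))
    (W : H2) (hW : ∀ z ∈ ball (0:ℂ) 1, H2.eval W z = w z)
    (Wn : ℕ → H2) (hWn : ∀ n : ℕ, ∀ z ∈ ball (0:ℂ) 1, H2.eval (Wn n) z = w z * (φ z) ^ n)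
    (m j : ℕ) : (inner ℂ (Wn m) (Wn (m + j)) : ℂ) = inner ℂ W (Wn j) := by
  have h1 := ev_tendsto (Wn m) (Wn (m + j))
  have h2 := ev_tendsto W (Wn j)
  have h3 : Tendsto (fun k => (∫ θ in (0:ℝ)..(2*Real.pi), H2.eval (Wn (m+j)) (circleMap 0 (rr k) θ) *
        (starRingEnd ℂ) (H2.eval (Wn m) (circleMap 0 (rr k) θ))) - (∫ θ in (0:ℝ)..(2*Real.pi), H2.eval (Wn j) (circleMap 0 (rr k) θ) *
        (starRingEnd ℂ) (H2.eval W (circleMap 0 (rr k) θ)))) atTop (𝓝 0) := by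
    refine squeeze_zero_norm (fun k => ?_) (B_defect φ hφ hb hl W m)
    have c1 := ev_cont (Wn (m+j)) k
    have c2 := ev_cont (Wn m) k
    have c3 := ev_cont (Wn j) k
    have c4 := ev_cont W k
    have c5 := cont_cm φ hφ k
    have i1 : IntervalIntegrable (fun θ => H2.eval (Wn (m+j)) (circleMap 0 (rr k) θ) *
        (starRingEnd ℂ) (H2.eval (Wn m) (circleMap 0 (rr k) θ))) volume 0 (2*Real.pi) :=
      (c1.mul (Complex.continuous_conj.comp c2)).intervalIntegrable _ _
    have i2 : IntervalIntegrable (fun θ => H2.eval (Wn j) (circleMap 0 (rr k) θ) *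
        (starRingEnd ℂ) (H2.eval W (circleMap 0 (rr k) θ))) volume 0 (2*Real.pi) :=
      (c3.mul (Complex.continuous_conj.comp c4)).intervalIntegrable _ _
    rw [← intervalIntegral.integral_sub i1 i2]
    apply intervalIntegral.norm_integral_le_of_norm_le Real.two_pi_pos.le
    · refine Eventually.of_forall fun θ _ => ?_
      have hz := cm_ball k θ
      rw [hWn _ _ hz, hWn _ _ hz, hWn _ _ hz, hW _ hz]
      set z := circleMap 0 (rr k) θ
      have e : w z * φ z ^ (m + j) * (starRingEnd ℂ) (w z * φ z ^ m) - w z * φ z ^ j * (starRingEnd ℂ) (w z)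
          = -((w z * (starRingEnd ℂ) (w z)) * φ z ^ j * (1 - (φ z * (starRingEnd ℂ) (φ z))^m)) := by
        simp only [map_mul, map_pow]; ring
      have h1 := pow_le_one₀ (n := 2*m) (norm_nonneg _) (hb _ hz)
      have e2 : ‖(1:ℂ) - ((‖φ z‖^2 : ℝ):ℂ)^m‖ = 1 - ‖φ z‖^(2*m) := by
        rw [← Complex.ofReal_pow, ← Complex.ofReal_one, ← Complex.ofReal_sub, Complex.norm_real,
          Real.norm_eq_abs, ← pow_mul, abs_of_nonneg (by linarith)]
      rw [e, norm_neg, Complex.mul_conj, Complex.mul_conj, Complex.normSq_eq_norm_sq,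
        Complex.normSq_eq_norm_sq, norm_mul, norm_mul, e2, Complex.norm_real, norm_pow (φ z),
        Real.norm_eq_abs, abs_of_nonneg (by positivity)]
      have h2 := pow_le_one₀ (n := j) (norm_nonneg _) (hb _ hz)
      gcongr
      exact mul_le_of_le_one_right (by positivity) h2
    · exact ((c4.norm.pow 2).mul (cont_def φ hφ k m)).intervalIntegrable _ _
  have h4 := tendsto_nhds_unique (h1.sub h2) h3
  rw [← mul_sub, mul_eq_zero, sub_eq_zero] at h4
  rcases h4 with h4 | h4
  · simp [Real.pi_pos.ne'] at h4
  · exact h4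

lemma B_isom (T : H2 →L[ℂ] H2)
    (h : ∀ m n : ℕ, (inner ℂ (T (lp.single 2 m 1)) (T (lp.single 2 n 1)) : ℂ) = if m = n then 1 else 0)
    (f : H2) : ‖T f‖ = ‖f‖ := by
  have ho : Orthonormal ℂ (fun n : ℕ => T (lp.single 2 n (1:ℂ))) := by
    rw [orthonormal_iff_ite]; exact h
  have hs : HasSum (fun i => lp.single 2 i (f i)) f := lp.hasSum_single (p := 2) (by norm_num) f
  have e : ∀ i, (lp.single 2 i (f i) : H2) = f i • lp.single 2 i (1:ℂ) := by
    intro i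
    rw [← lp.single_smul]; simp
  have hT : HasSum (fun i => f i • T (lp.single 2 i (1:ℂ))) (T f) := by
    have := T.hasSum hs
    refine this.congr_fun fun i => ?_
    simp [e]
  have h2 := ho.orthogonalFamily.hasSum_linearIsometry f
  have h3 : T f = ho.orthogonalFamily.linearIsometry f := by
    refine hT.unique (h2.congr_fun fun i => ?_)
    simp
  rw [h3, LinearIsometry.norm_map]

lemma J_order (w : ℂ → ℂ) (hw : DifferentiableOn ℂ w (ball (0:ℂ) 1))
    (W : H2) (hW : ∀ z ∈ ball (0:ℂ) 1, H2.eval W z = w z) (hW0 : W ≠ 0) :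
    ∀ u ∈ ball (0:ℂ) 1, analyticOrderAt w u ≠ ⊤ := by
  intro u hu h
  have ha := hw.analyticOnNhd isOpen_ball
  rw [analyticOrderAt_eq_top] at h
  have h2 := ha.eqOn_zero_of_preconnected_of_eventuallyEq_zero
    (convex_ball (0:ℂ) 1).isPreconnected hu h
  apply hW0
  refine ev_inj W 0 fun z hz => ?_
  rw [hW z hz, h2 hz]
  simp [H2.eval]

lemma J_cb (k : ℕ) : closedBall (0:ℂ) |rr k| ⊆ ball (0:ℂ) 1 :=
  closedBall_subset_ball (by rw [abs_of_pos (rr_pos k)]; exact rr_lt k)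

lemma J_ne (w : ℂ → ℂ) (hw : DifferentiableOn ℂ w (ball (0:ℂ) 1))
    (W : H2) (hW : ∀ z ∈ ball (0:ℂ) 1, H2.eval W z = w z) (hW0 : W ≠ 0) (k : ℕ) :
    ∀ᵐ θ : ℝ, w (circleMap 0 (rr k) θ) ≠ 0 := by
  have ha := hw.analyticOnNhd isOpen_ball
  have hs : sphere (0:ℂ) |rr k| ⊆ ball (0:ℂ) 1 := sphere_subset_closedBall.trans (J_cb k)
  have h1 := MeromorphicAt.MeromorphicOn.codiscreteWithin_setOfPred_ne_zero (ha.mono hs).meromorphicOn (by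
    intro u hu
    rw [(ha u (hs hu)).meromorphicOrderAt_eq]
    have := J_order w hw W hW hW0 u (hs hu)
    simpa using this)
  have h2 := circleMap_preimage_codiscrete (c := 0) (rr_pos k).ne' h1
  have h3 := ae_restrict_le_codiscreteWithin (U := (Set.univ : Set ℝ)) (μ := volume) MeasurableSet.univ h2
  rw [Measure.restrict_univ] at h3
  exact h3

lemma J_int (w : ℂ → ℂ) (hw : DifferentiableOn ℂ w (ball (0:ℂ) 1)) (k : ℕ) :
    IntervalIntegrable (fun θ => Real.log ‖w (circleMap 0 (rr k) θ)‖) volume 0 (2*Real.pi) := by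
  have ha := hw.analyticOnNhd isOpen_ball
  have hs : sphere (0:ℂ) |rr k| ⊆ ball (0:ℂ) 1 := sphere_subset_closedBall.trans (J_cb k)
  exact (ha.mono hs).meromorphicOn.circleIntegrable_log_norm

lemma J_bound (w : ℂ → ℂ) (hw : DifferentiableOn ℂ w (ball (0:ℂ) 1)) :
    ∃ C : ℝ, ∀ k, C ≤ ∫ θ in (0:ℝ)..(2*Real.pi), Real.log ‖w (circleMap 0 (rr k) θ)‖ := by
  have ha := hw.analyticOnNhd isOpen_ball
  have hpi := Real.pi_pos
  have h00 : ∀ k, (0:ℂ) ∈ closedBall (0:ℂ) |rr k| := fun k => by simp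
  refine ⟨(2*Real.pi) * ((((analyticOrderAt w 0).map (Nat.cast : ℕ → ℤ)).untop₀ : ℝ) * Real.log (1/2)
    + Real.log ‖meromorphicTrailingCoeffAt w 0‖), fun k => ?_⟩
  have hak := ha.mono (J_cb k)
  have hJ := hak.meromorphicOn.circleAverage_log_norm (rr_pos k).ne'
  have hd := MeromorphicOn.AnalyticOnNhd.divisor_nonneg hak
  rw [MeromorphicOn.AnalyticOnNhd.divisor_apply hak (h00 k)] at hJ
  have hd0 := hd 0
  rw [MeromorphicOn.AnalyticOnNhd.divisor_apply hak (h00 k)] at hd0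
  have hsum : 0 ≤ ∑ᶠ u, (MeromorphicOn.divisor w (closedBall 0 |rr k|) u : ℝ) * Real.log (rr k * ‖0 - u‖⁻¹) := by
    apply finsum_nonneg
    intro u
    by_cases hu : u ∈ closedBall (0:ℂ) |rr k|
    · apply mul_nonneg
      · exact_mod_cast hd u
      · by_cases hu0 : u = 0
        · simp [hu0]
        apply Real.log_nonneg
        rw [mem_closedBall_zero_iff, abs_of_pos (rr_pos k)] at hu
        rw [zero_sub, norm_neg, ← div_eq_mul_inv, one_le_div (norm_pos_iff.2 hu0)]
        exact hu
    · rw [Function.locallyFinsuppWithin.apply_eq_zero_of_notMem _ hu]; simp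
  have hlog : Real.log (1/2) ≤ Real.log (rr k) := Real.log_le_log (by norm_num) (rr_half k)
  have hd0' : (0:ℝ) ≤ (((analyticOrderAt w 0).map (Nat.cast : ℕ → ℤ)).untop₀ : ℝ) := by exact_mod_cast hd0
  have h5 := mul_le_mul_of_nonneg_left hlog hd0'
  rw [Real.circleAverage_def, smul_eq_mul] at hJ
  have h6 : (∫ θ in (0:ℝ)..(2*Real.pi), Real.log ‖w (circleMap 0 (rr k) θ)‖) = (2*Real.pi) * ((2*Real.pi)⁻¹ * ∫ θ in (0:ℝ)..(2*Real.pi), Real.log ‖w (circleMap 0 (rr k) θ)‖) := by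
    field_simp
  rw [h6, hJ]
  apply mul_le_mul_of_nonneg_left _ (by positivity)
  linarith

lemma N_null0 (φ w : ℂ → ℂ) (hφ : DifferentiableOn ℂ φ (ball (0:ℂ) 1))
    (hb : ∀ z ∈ ball (0:ℂ) 1, ‖φ z‖ ≤ 1) (hw : DifferentiableOn ℂ w (ball (0:ℂ) 1))
    (W : H2) (hW : ∀ z ∈ ball (0:ℂ) 1, H2.eval W z = w z)
    (V : H2) (hV : ∀ z ∈ ball (0:ℂ) 1, H2.eval V z = w z * φ z)
    (hW1 : ‖W‖ = 1) (hV1 : ‖V‖ = 1) (c : ℝ) (hc0 : 0 ≤ c) (hc : c < 1) (K : ℕ) :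
    volume ({θ : ℝ | ∀ k, K ≤ k → ‖φ (circleMap 0 (rr k) θ)‖ ≤ c} ∩ Set.Ioc 0 (2*Real.pi)) = 0 := by
  set E : Set ℝ := {θ : ℝ | ∀ k, K ≤ k → ‖φ (circleMap 0 (rr k) θ)‖ ≤ c} with hE
  have hEc : IsClosed E := by
    have : E = ⋂ k, ⋂ (_ : K ≤ k), {θ : ℝ | ‖φ (circleMap 0 (rr k) θ)‖ ≤ c} := by
      ext θ; simp [hE]
    rw [this]
    exact isClosed_iInter fun k => isClosed_iInter fun _ =>
      isClosed_le (cont_cm φ hφ k).norm continuous_const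
  have hW0 : W ≠ 0 := by rintro rfl; simp at hW1
  obtain ⟨C, hC⟩ := J_bound w hw
  set S : Set ℝ := Set.Ioc 0 (2*Real.pi) ∩ E with hS
  have hSm : MeasurableSet S := measurableSet_Ioc.inter hEc.measurableSet
  have hSfin : volume S ≠ ⊤ := by
    refine ne_top_of_le_ne_top ?_ (measure_mono Set.inter_subset_left)
    exact measure_Ioc_lt_top.ne
  rw [Set.inter_comm]
  have hpi := Real.two_pi_pos
  have hc2 : 0 < 1 - c^2 := by nlinarith
  have key : ∀ t : ℝ, t * volume.real S ≤ 2 * Real.pi - 2 * C := by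
    intro t
    have hstep : ∀ k, K ≤ k → 2 * C + t * volume.real S ≤
        (∫ θ in (0:ℝ)..(2*Real.pi), ‖H2.eval W (circleMap 0 (rr k) θ)‖^2) +
        Real.exp t * (((∫ θ in (0:ℝ)..(2*Real.pi), ‖H2.eval W (circleMap 0 (rr k) θ)‖^2) -
          (∫ θ in (0:ℝ)..(2*Real.pi), ‖H2.eval V (circleMap 0 (rr k) θ)‖^2)) / (1 - c^2)) := by
      intro k hk
      have cW := (ev_cont W k).norm.pow 2
      have cV := (ev_cont V k).norm.pow 2
      set F : ℝ → ℝ := fun θ => ‖H2.eval W (circleMap 0 (rr k) θ)‖^2 with hF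
      set G : ℝ → ℝ := fun θ => ‖H2.eval V (circleMap 0 (rr k) θ)‖^2 with hG
      have iF : IntegrableOn F (Set.Ioc 0 (2*Real.pi)) := (cW.integrableOn_Ioc)
      have iG : IntegrableOn G (Set.Ioc 0 (2*Real.pi)) := (cV.integrableOn_Ioc)
      have iFS : IntegrableOn F S := iF.mono_set Set.inter_subset_left
      have iGS : IntegrableOn G S := iG.mono_set Set.inter_subset_left
      have hGF : ∀ θ, G θ = F θ * ‖φ (circleMap 0 (rr k) θ)‖^2 := by
        intro θ
        simp only [hG, hF]
        rw [hV _ (cm_ball k θ), hW _ (cm_ball k θ), norm_mul, mul_pow]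
      have hF0 : ∀ θ, 0 ≤ F θ := fun θ => by simp only [hF]; positivity
      have hGle : ∀ θ, G θ ≤ F θ := by
        intro θ
        rw [hGF]
        exact mul_le_of_le_one_right (hF0 θ) (pow_le_one₀ (norm_nonneg _) (hb _ (cm_ball k θ)))
      have s1 : (1 - c^2) * ∫ θ in S, F θ ≤ ∫ θ in S, (F θ - G θ) := by
        rw [← integral_const_mul]
        refine setIntegral_mono_on (iFS.const_mul _) (iFS.sub iGS) hSm fun θ hθ => ?_
        rw [hGF]
        have h1 := pow_le_pow_left₀ (norm_nonneg _) (hθ.2 k hk) 2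
        nlinarith [hF0 θ, mul_le_mul_of_nonneg_left h1 (hF0 θ)]
      have s2 : ∫ θ in S, (F θ - G θ) ≤ ∫ θ in Set.Ioc 0 (2*Real.pi), (F θ - G θ) := by
        refine setIntegral_mono_set (iF.sub iG) (Eventually.of_forall fun θ => ?_)
          (Eventually.of_forall Set.inter_subset_left)
        simpa using hGle θ
      rw [integral_sub iF iG] at s2
      have s3 : ∫ θ in S, F θ ≤ ((∫ θ in Set.Ioc 0 (2*Real.pi), F θ) - ∫ θ in Set.Ioc 0 (2*Real.pi), G θ) / (1 - c^2) := by
        rw [le_div_iff₀ hc2]; linarith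
      have iH : IntegrableOn (fun θ => Real.exp t * F θ - t) S :=
        (iFS.const_mul _).sub (integrableOn_const hSfin)
      have iH2 : IntegrableOn (E.indicator (fun θ => Real.exp t * F θ - t)) (Set.Ioc 0 (2*Real.pi)) := by
        rw [IntegrableOn, integrable_indicator_iff hEc.measurableSet, IntegrableOn,
          Measure.restrict_restrict hEc.measurableSet, Set.inter_comm]
        exact iH
      have iL : IntegrableOn (fun θ => 2 * Real.log ‖w (circleMap 0 (rr k) θ)‖) (Set.Ioc 0 (2*Real.pi)) :=
        ((intervalIntegrable_iff_integrableOn_Ioc_of_le hpi.le).1 (J_int w hw k)).const_mul 2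
      have s4 : ∫ θ in Set.Ioc 0 (2*Real.pi), 2 * Real.log ‖w (circleMap 0 (rr k) θ)‖ ≤
          ∫ θ in Set.Ioc 0 (2*Real.pi), (F θ + E.indicator (fun θ => Real.exp t * F θ - t) θ) := by
        refine setIntegral_mono_ae iL (iF.add iH2) ?_
        filter_upwards [J_ne w hw W hW hW0 k] with θ hθ
        have hFp : 0 < F θ := by
          simp only [hF]; rw [hW _ (cm_ball k θ)]
          have := norm_pos_iff.2 hθ
          positivity
        have e1 : 2 * Real.log ‖w (circleMap 0 (rr k) θ)‖ = Real.log (F θ) := by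
          simp only [hF]; rw [hW _ (cm_ball k θ), Real.log_pow]; norm_num
        rw [e1]
        by_cases hθE : θ ∈ E
        · rw [Set.indicator_of_mem hθE]
          have h1 := Real.log_le_sub_one_of_pos (mul_pos (Real.exp_pos t) hFp)
          rw [Real.log_mul (Real.exp_pos t).ne' hFp.ne', Real.log_exp] at h1
          linarith
        · rw [Set.indicator_of_notMem hθE]
          linarith [Real.log_le_sub_one_of_pos hFp]
      rw [integral_add iF iH2, setIntegral_indicator hEc.measurableSet, ← hS,
        integral_sub (iFS.const_mul _) (integrableOn_const hSfin), integral_const_mul, integral_const_mul,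
        setIntegral_const, smul_eq_mul] at s4
      have s5 := hC k
      rw [intervalIntegral.integral_of_le hpi.le] at s5 ⊢
      rw [intervalIntegral.integral_of_le hpi.le]
      have s6 := mul_le_mul_of_nonneg_left s3 (Real.exp_pos t).le
      linarith
    have l1 := ev_sq_tendsto W
    have l2 := ev_sq_tendsto V
    have l3 := l1.add (((l1.sub l2).div_const (1 - c^2)).const_mul (Real.exp t))
    have l4 := ge_of_tendsto l3 (eventually_atTop.2 ⟨K, hstep⟩)
    rw [hW1, hV1] at l4
    simp at l4
    linarith
  have hr : volume.real S = 0 := by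
    by_contra hne
    have hpos : 0 < volume.real S := lt_of_le_of_ne measureReal_nonneg (Ne.symm hne)
    have := key ((2 * Real.pi - 2 * C + 1) / volume.real S)
    rw [div_mul_cancel₀ _ hne] at this
    linarith
  exact (measureReal_eq_zero_iff hSfin).1 hr

lemma N_null (φ w : ℂ → ℂ) (hφ : DifferentiableOn ℂ φ (ball (0:ℂ) 1))
    (hb : ∀ z ∈ ball (0:ℂ) 1, ‖φ z‖ ≤ 1) (hw : DifferentiableOn ℂ w (ball (0:ℂ) 1))
    (W : H2) (hW : ∀ z ∈ ball (0:ℂ) 1, H2.eval W z = w z)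
    (V : H2) (hV : ∀ z ∈ ball (0:ℂ) 1, H2.eval V z = w z * φ z)
    (hW1 : ‖W‖ = 1) (hV1 : ‖V‖ = 1) (c : ℝ) (hc0 : 0 ≤ c) (hc : c < 1) (K : ℕ) :
    volume {θ : ℝ | ∀ k, K ≤ k → ‖φ (circleMap 0 (rr k) θ)‖ ≤ c} = 0 := by
  have h0 := N_null0 φ w hφ hb hw W hW V hV hW1 hV1 c hc0 hc K
  have hfd := isAddFundamentalDomain_Ioc Real.two_pi_pos 0
  rw [zero_add] at hfd
  refine hfd.measure_zero_of_invariant _ ?_ h0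
  rintro ⟨g, hg⟩
  obtain ⟨n, rfl⟩ := AddSubgroup.mem_zmultiples_iff.1 hg
  ext θ
  rw [Set.mem_vadd_set_iff_neg_vadd_mem]
  have e : ∀ k, circleMap 0 (rr k) (-(n • (2 * Real.pi)) + θ) = circleMap 0 (rr k) θ := by
    intro k
    have := (periodic_circleMap 0 (rr k)).int_mul (-n) θ
    rw [← this]; congr 1; simp; ring
  simp only [Set.mem_ofPred_eq, AddSubgroup.vadd_def, vadd_eq_add, AddSubgroup.coe_neg, e]

lemma N_inner (φ w : ℂ → ℂ) (hφ : DifferentiableOn ℂ φ (ball (0:ℂ) 1))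
    (hb : ∀ z ∈ ball (0:ℂ) 1, ‖φ z‖ ≤ 1) (hw : DifferentiableOn ℂ w (ball (0:ℂ) 1))
    (hfat : ∀ᵐ θ : ℝ, ∃ l : ℂ, Tendsto (fun r : ℝ => φ ((r:ℂ) * Complex.exp (θ * Complex.I))) (𝓝[<] 1) (𝓝 l))
    (W : H2) (hW : ∀ z ∈ ball (0:ℂ) 1, H2.eval W z = w z)
    (V : H2) (hV : ∀ z ∈ ball (0:ℂ) 1, H2.eval V z = w z * φ z)
    (hW1 : ‖W‖ = 1) (hV1 : ‖V‖ = 1) : IsInnerFn φ := by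
  refine ⟨hφ, hb, ?_⟩
  have h1 : ∀ᵐ θ : ℝ, ∀ m K : ℕ, ¬ (∀ k, K ≤ k → ‖φ (circleMap 0 (rr k) θ)‖ ≤ rr m) := by
    rw [ae_all_iff]; intro m
    rw [ae_all_iff]; intro K
    rw [ae_iff]
    simpa using N_null φ w hφ hb hw W hW V hV hW1 hV1 (rr m) (rr_pos m).le (rr_lt m) K
  filter_upwards [h1, hfat] with θ hθ ⟨l, hl⟩
  refine ⟨l, ?_, hl⟩
  have h2 : Tendsto (fun k => ‖φ (circleMap 0 (rr k) θ)‖) atTop (𝓝 ‖l‖) := by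
    have := (hl.comp rr_tendsto').norm
    simpa [circleMap_zero, Function.comp_def] using this
  apply le_antisymm
  · exact le_of_tendsto h2 (Eventually.of_forall fun k => hb _ (cm_ball k θ))
  · by_contra! hlt
    obtain ⟨m, hm⟩ := (rr_tendsto.eventually (lt_mem_nhds hlt)).exists
    obtain ⟨K, hK⟩ := eventually_atTop.1 (h2.eventually (gt_mem_nhds hm))
    exact hθ m K fun k hk => (hK k hk).le

/-- Let `φ : 𝔻 → 𝔻` be holomorphic and `w ∈ H²` such that `T = T_{w,φ}`
is bounded on `H²`.  Then `T` is an isometry on `H²` if and only if `φ` is inner,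
`‖w‖₂ = 1` and `⟨w, w·φⁿ⟩ = 0` for all `n ≥ 1`.  (Here `W` represents `w` and `Wn n`
represents `w·φⁿ` as elements of `H²`.) -/
theorem isometry_iff_inner_and_orthogonality
    (φ w : ℂ → ℂ)
    (hφ : DifferentiableOn ℂ φ (ball (0:ℂ) 1))
    (hφmaps : Set.MapsTo φ (ball (0:ℂ) 1) (ball (0:ℂ) 1))
    (hw : DifferentiableOn ℂ w (ball (0:ℂ) 1))
    (W : H2) (hW : ∀ z ∈ ball (0:ℂ) 1, H2.eval W z = w z)
    (Wn : ℕ → H2) (hWn : ∀ n : ℕ, ∀ z ∈ ball (0:ℂ) 1, H2.eval (Wn n) z = w z * (φ z) ^ n)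
    (T : H2 →L[ℂ] H2)
    (hT : ∀ (f : H2), ∀ z ∈ ball (0:ℂ) 1, H2.eval (T f) z = w z * H2.eval f (φ z)) :
    (∀ f : H2, ‖T f‖ = ‖f‖) ↔
      (IsInnerFn φ ∧ ‖W‖ = 1 ∧ ∀ n : ℕ, 1 ≤ n → (inner ℂ W (Wn n) : ℂ) = 0) := by
  have hb : ∀ z ∈ ball (0:ℂ) 1, ‖φ z‖ ≤ 1 := fun z hz => by
    have := hφmaps hz
    rw [mem_ball_zero_iff] at this
    exact this.le
  have hTn : ∀ n, T (lp.single 2 n (1:ℂ)) = Wn n := by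
    intro n
    refine ev_inj _ _ fun z hz => ?_
    rw [hT _ z hz, ev_single, hWn n z hz, one_mul]
  have hW0 : Wn 0 = W := by
    refine ev_inj _ _ fun z hz => ?_
    rw [hWn 0 z hz, hW z hz, pow_zero, mul_one]
  constructor
  · intro hiso
    have hn : ∀ n, ‖Wn n‖ = 1 := by
      intro n
      rw [← hTn, hiso, lp.norm_single (by norm_num)]; simp
    refine ⟨N_inner φ w hφ hb hw (aux_fatou φ hφ hb) W hW (Wn 1) (fun z hz => by rw [hWn 1 z hz, pow_one])
      (by rw [← hW0]; exact hn 0) (hn 1), by rw [← hW0]; exact hn 0, fun n hn1 => ?_⟩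
    let L : H2 →ₗᵢ[ℂ] H2 := ⟨T.toLinearMap, hiso⟩
    have h := L.inner_map_map (lp.single 2 0 (1:ℂ)) (lp.single 2 n (1:ℂ))
    change inner ℂ (T _) (T _) = _ at h
    rw [hTn, hTn, hW0, lp.inner_single_left] at h
    rw [h]
    have : n ≠ 0 := by omega
    simp [this.symm]
  · rintro ⟨⟨-, -, hl⟩, hW1, hort⟩
    have hI : ∀ m j, (inner ℂ (Wn m) (Wn (m + j)) : ℂ) = if j = 0 then 1 else 0 := by
      intro m j
      rw [B_inner φ w hφ hb hl W hW Wn hWn m j]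
      split_ifs with hj
      · subst hj
        rw [hW0, inner_self_eq_norm_sq_to_K, hW1]; simp
      · exact hort j (by omega)
    refine B_isom T fun m n => ?_
    rw [hTn, hTn]
    rcases le_total m n with h | h
    · obtain ⟨j, rfl⟩ := Nat.exists_eq_add_of_le h
      rw [hI]; simp
    · obtain ⟨j, rfl⟩ := Nat.exists_eq_add_of_le h
      rw [← inner_conj_symm, hI]
      by_cases hj : j = 0 <;> simp [hj]
end
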